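/- arXiv:2202.11293 — 3 statements merged into one kernel-verified Lean document; each statement's English description precedes it below -/
import Mathlib

section
/- If α is a Liouville number with |α| ≤ 1, then arcsin α is transcendental. -/
namespace LiouvilleArcsin

open Polynomial
open scoped Nat

noncomputable section

/-- The Hermite remainder. -/
def hermiteRem (f : ℂ[X]) (s : ℂ) : ℂ :=
  Complex.exp s * f.sumIDeriv.eval 0 - f.sumIDeriv.eval s

theorem hermiteRem_eq (f : ℂ[X]) (s : ℂ) :
    hermiteRem f s =
      Complex.exp s * (s * ∫ x in (0:ℝ)..1, Complex.exp (-(x • s)) * f.eval (x • s)) := by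
  rw [LindemannWeierstrass.integral_exp_mul_eval, mul_add, mul_neg, Complex.exp_neg,
    mul_inv_cancel_left₀ (Complex.exp_ne_zero s), neg_add_eq_sub, hermiteRem]

theorem hermiteRem_le (f : ℂ[X]) (s : ℂ) (M : ℝ)
    (hM : ∀ x ∈ Set.Ioc (0 : ℝ) 1, ‖f.eval (x • s)‖ ≤ M) :
    ‖hermiteRem f s‖ ≤ Real.exp ‖s‖ * ‖s‖ * Real.exp ‖s‖ * M := by
  have h1 : ‖∫ x in (0:ℝ)..1, Complex.exp (-(x • s)) * f.eval (x • s)‖ ≤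
      Real.exp ‖s‖ * M * |1 - 0| := by
    apply intervalIntegral.norm_integral_le_of_norm_le_const
    intro x hx
    rw [Set.uIoc_of_le zero_le_one] at hx
    rw [norm_mul, Complex.norm_exp]
    gcongr
    · apply (Complex.re_le_norm _).trans
      rw [norm_neg, norm_smul, Real.norm_of_nonneg hx.1.le]
      exact mul_le_of_le_one_left (norm_nonneg _) hx.2
    · exact hM x hx
  rw [hermiteRem_eq, norm_mul, norm_mul, Complex.norm_exp]
  have h2 := Complex.re_le_norm s
  simp only [sub_zero, abs_one, mul_one] at h1
  calc _ ≤ Real.exp ‖s‖ * (‖s‖ * (Real.exp ‖s‖ * M)) := by gcongr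
    _ = _ := by ring

theorem hermiteRem_bound (f : ℤ[X]) (s : ℂ) :
    ∃ c ≥ (1:ℝ), ∀ p ≠ 0,
      ‖hermiteRem (map (algebraMap ℤ ℂ) (X ^ (p - 1) * f ^ p)) s‖ ≤ c ^ p := by
  have hcomp : IsCompact ((fun x : ℝ ↦ ‖aeval (x • s) f‖) '' Set.Icc 0 1) := by
    apply isCompact_Icc.image
    fun_prop
  obtain ⟨M, hM⟩ := hcomp.isBounded.exists_norm_le
  set M' := max M 1
  set S := max ‖s‖ 1
  set k := max (Real.exp ‖s‖ * ‖s‖ * Real.exp ‖s‖) 1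
  have hM1 : 1 ≤ M' := le_max_right _ _
  have hS1 : 1 ≤ S := le_max_right _ _
  have hk1 : 1 ≤ k := le_max_right _ _
  refine ⟨k * (S * M'), one_le_mul_of_one_le_of_one_le hk1
    (one_le_mul_of_one_le_of_one_le hS1 hM1), fun p hp => ?_⟩
  refine (hermiteRem_le _ s ((S * M') ^ p) ?_).trans ?_
  · intro x hx
    have h1 : ‖aeval (x • s) f‖ ≤ M' := by
      have := hM _ ⟨x, ⟨hx.1.le, hx.2⟩, rfl⟩
      rw [norm_norm] at this
      exact this.trans (le_max_left _ _)
    have h2 : ‖x • s‖ ≤ S := by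
      rw [norm_smul, Real.norm_of_nonneg hx.1.le]
      exact (mul_le_of_le_one_left (norm_nonneg _) hx.2).trans (le_max_left _ _)
    simp only [Polynomial.map_mul, Polynomial.map_pow, map_X, eval_mul, eval_pow, eval_X, norm_mul,
      norm_pow, ← eval₂_eq_eval_map, ← aeval_def]
    rw [mul_pow]
    gcongr
    calc ‖x • s‖ ^ (p-1) ≤ S ^ (p-1) := by gcongr
      _ ≤ S ^ p := pow_le_pow_right₀ hS1 (Nat.sub_le _ _)
  · rw [mul_pow k]
    gcongr
    exact (le_max_left _ _).trans (le_self_pow₀ hk1 hp)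

theorem coeff_mul_bound (f g : ℤ[X]) (M : ℝ) (hM : ∀ k, |(g.coeff k : ℝ)| ≤ M) (k : ℕ) :
    |((f * g).coeff k : ℝ)| ≤ (∑ i ∈ f.support, |(f.coeff i : ℝ)|) * M := by
  have hM0 : 0 ≤ M := (abs_nonneg _).trans (hM 0)
  rw [coeff_mul, Finset.Nat.sum_antidiagonal_eq_sum_range_succ (fun i j => f.coeff i * g.coeff j)]
  push_cast
  refine (Finset.abs_sum_le_sum_abs _ _).trans ?_
  calc ∑ i ∈ Finset.range k.succ, |(f.coeff i : ℝ) * (g.coeff (k - i) : ℝ)|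
      ≤ ∑ i ∈ Finset.range k.succ, |(f.coeff i : ℝ)| * M := by
        gcongr with i hi
        rw [abs_mul]
        gcongr
        exact hM _
    _ = (∑ i ∈ Finset.range k.succ, |(f.coeff i : ℝ)|) * M := by rw [Finset.sum_mul]
    _ ≤ _ := by
        refine mul_le_mul_of_nonneg_right ?_ hM0
        rw [← Finset.sum_filter_ne_zero]
        refine Finset.sum_le_sum_of_subset_of_nonneg ?_ (fun _ _ _ => abs_nonneg _)
        intro i hi
        simpa using (Finset.mem_filter.1 hi).2

theorem coeff_pow_bound (f : ℤ[X]) (p m k : ℕ) :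
    |((X ^ m * f ^ p).coeff k : ℝ)| ≤ (∑ i ∈ f.support, |(f.coeff i : ℝ)|) ^ p := by
  induction p generalizing k with
  | zero =>
    simp only [pow_zero, mul_one, coeff_X_pow]
    split_ifs <;> simp
  | succ p ih =>
    have : X ^ m * f ^ (p+1) = f * (X ^ m * f ^ p) := by ring
    rw [this, pow_succ']
    exact coeff_mul_bound _ _ _ ih k

theorem eval_zero_sumIDeriv_bound (F : ℤ[X]) (M : ℝ) (N : ℕ) (hN : F.natDegree < N)
    (hM : ∀ k, |(F.coeff k : ℝ)| ≤ M) :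
    |((F.sumIDeriv.eval 0 : ℤ) : ℝ)| ≤ N ! * M := by
  rw [sumIDeriv_apply_of_lt hN, eval_finsetSum]
  push_cast
  refine (Finset.abs_sum_le_sum_abs _ _).trans ?_
  have hM0 : 0 ≤ M := (abs_nonneg _).trans (hM 0)
  have hN0 : N ≠ 0 := by omega
  calc _ ≤ ∑ i ∈ Finset.range N, ((N - 1)! : ℝ) * M := by
        apply Finset.sum_le_sum
        intro i hi
        rw [← coeff_zero_eq_eval_zero, coeff_iterate_derivative, zero_add, Nat.descFactorial_self]
        simp only [nsmul_eq_mul]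
        push_cast
        rw [abs_mul, Nat.abs_cast]
        have : i ! ≤ (N-1)! := Nat.factorial_le (by have := Finset.mem_range.1 hi; omega)
        gcongr
        exact hM _
    _ = _ := by
        rw [Finset.sum_const, Finset.card_range, nsmul_eq_mul, ← mul_assoc, ← Nat.cast_mul,
          Nat.mul_factorial_pred hN0]

theorem hermite_approx (f : ℤ[X]) (hf : f.eval 0 ≠ 0) :
    ∃ c ≥ (1:ℝ), ∀ p > (eval 0 f).natAbs, p.Prime →
      ∃ n : ℤ, ¬ (p:ℤ) ∣ n ∧ |(n:ℝ)| ≤ c ^ p * (p * (f.natDegree + 1))! ∧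
        ∃ gp : ℤ[X], gp.natDegree ≤ p * f.natDegree ∧
          ∀ r : ℂ, aeval r f = 0 →
            ‖(n:ℂ) * Complex.exp r - p * aeval r gp‖ ≤ c ^ p / (p - 1)! := by
  have hf0 : f ≠ 0 := by rintro rfl; simp at hf
  choose c' c'1 hc' using hermiteRem_bound f
  set L : ℝ := ∑ i ∈ f.support, |(f.coeff i : ℝ)| with hL
  have hL0 : 0 ≤ L := Finset.sum_nonneg fun _ _ => abs_nonneg _
  have hsum0 : 0 ≤ ∑ r ∈ (f.aroots ℂ).toFinset, c' r :=
    Finset.sum_nonneg fun r _ => zero_le_one.trans (c'1 r)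
  refine ⟨1 + L + ∑ r ∈ (f.aroots ℂ).toFinset, c' r, by linarith, ?_⟩
  intro p p_gt prime_p
  obtain ⟨gp', -, h'⟩ := eval_sumIDeriv_of_pos (X ^ (p - 1) * f ^ p) prime_p.pos
  specialize h' 0 (by rw [C_0, sub_zero])
  have hn : eval 0 (sumIDeriv (X ^ (p - 1) * f ^ p)) =
      (p-1)! * (f.eval 0 ^ p + p * gp'.eval 0) := by
    rw [h', ← Nat.mul_factorial_pred prime_p.ne_zero]
    simp only [nsmul_eq_mul, eval_pow]
    push_cast
    ring
  have hfac : (1:ℝ) ≤ (p-1)! := by exact_mod_cast Nat.factorial_pos _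
  refine ⟨f.eval 0 ^ p + p * gp'.eval 0, ?_, ?_, ?_⟩
  · rw [dvd_add_left (dvd_mul_right _ _)]
    contrapose! p_gt with h
    exact Nat.le_of_dvd (Int.natAbs_pos.mpr hf) (Int.natCast_dvd.mp (Int.Prime.dvd_pow' prime_p h))
  · have hdeg : (X ^ (p - 1) * f ^ p).natDegree < p * (f.natDegree + 1) := by
      refine natDegree_mul_le.trans_lt ?_
      rw [natDegree_X_pow, natDegree_pow, mul_add]
      have := prime_p.pos
      omega
    have hb := eval_zero_sumIDeriv_bound _ (L ^ p) _ hdeg (coeff_pow_bound f p (p-1))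
    rw [hn] at hb
    push_cast at hb ⊢
    rw [abs_mul, Nat.abs_cast] at hb
    calc _ ≤ ((p-1)! : ℝ) * |(↑(eval 0 f) ^ p + ↑p * ↑(eval 0 gp') : ℝ)| :=
          le_mul_of_one_le_left (abs_nonneg _) hfac
      _ ≤ _ := hb
      _ = L ^ p * (p * (f.natDegree + 1))! := by ring
      _ ≤ _ := by gcongr; linarith
  obtain ⟨gp, gp'_le, h⟩ := aeval_sumIDeriv ℂ (X ^ (p - 1) * f ^ p) p
  refine ⟨gp, ?_, ?_⟩
  · refine gp'_le.trans ((tsub_le_tsub_right natDegree_mul_le p).trans ?_)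
    rw [natDegree_X_pow, natDegree_pow]
    omega
  intro r hr
  have hmem : r ∈ (f.aroots ℂ).toFinset := by
    rw [Multiset.mem_toFinset, mem_aroots]
    exact ⟨hf0, hr⟩
  specialize h r _
  · rw [Polynomial.map_mul, f.map_pow]
    refine dvd_mul_of_dvd_right (pow_dvd_pow_of_dvd (dvd_iff_isRoot.mpr ?_) _) _
    rw [IsRoot, ← eval₂_eq_eval_map, ← aeval_def]
    exact hr
  rw [nsmul_eq_mul] at h
  have key : ((((f.eval 0 ^ p + p * gp'.eval 0 : ℤ)):ℂ) * Complex.exp r - p * aeval r gp) *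
      (p - 1)! = hermiteRem (map (algebraMap ℤ ℂ) (X ^ (p - 1) * f ^ p)) r := by
    rw [hermiteRem, ← aeval_sumIDeriv_eq_eval, ← aeval_sumIDeriv_eq_eval, h]
    have h0 : (aeval (0:ℂ)) (sumIDeriv (X ^ (p - 1) * f ^ p)) =
        ((eval 0 (sumIDeriv (X ^ (p - 1) * f ^ p)) : ℤ) : ℂ) := by
      rw [← eq_intCast (algebraMap ℤ ℂ), ← aeval_algebraMap_apply_eq_algebraMap_eval, map_zero]
    rw [h0, hn, ← Nat.mul_factorial_pred prime_p.ne_zero]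
    push_cast
    ring
  rw [le_div_iff₀ (by linarith)]
  have e1 : ((p-1)! : ℝ) = ‖((p-1)! : ℂ)‖ := by simp
  rw [e1, ← norm_mul, key]
  refine (hc' r p prime_p.ne_zero).trans ?_
  have := Finset.single_le_sum (f := c') (fun r _ => zero_le_one.trans (c'1 r)) hmem
  have := c'1 r
  gcongr
  linarith

/-- Choice of the prime. -/
theorem factorial_pow_le (m n : ℕ) : (m !) ^ n ≤ (n * m)! := by
  induction n with
  | zero => simp
  | succ n ih =>
    rw [pow_succ, add_mul, one_mul]
    exact (Nat.mul_le_mul_right _ ih).trans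
      (Nat.le_of_dvd (Nat.factorial_pos _) (Nat.factorial_mul_factorial_dvd_factorial_add _ _))

theorem choose_prime (c : ℝ) (hc : 1 ≤ c) (d D p0 : ℕ) :
    ∃ E X0 : ℕ, ∀ X : ℕ, X0 ≤ X → ∃ p : ℕ, p.Prime ∧ p0 < p ∧
      c ^ p * (X:ℝ) ^ d / (p-1)! ≤ 1 / 2 ∧
      c ^ p * (p * (D+1))! * (X:ℝ) ^ d ≤ (X:ℝ) ^ E := by
  set E0 := d + 2 with hE0
  set w := 2 * E0 * (D + 1) with hw
  set k1 : ℝ := c ^ (2 * E0) with hk1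
  set k2 : ℝ := (w:ℝ) ^ w * Real.exp 1 ^ w with hk2
  have hev : ∀ᶠ M : ℕ in Filter.atTop, k1 ^ M / M ! < 1/2 ∧ k2 ^ M / M ! < 1/2 :=
    ((FloorSemiring.tendsto_pow_div_factorial_atTop k1).eventually_lt_const (by norm_num)).and
    ((FloorSemiring.tendsto_pow_div_factorial_atTop k2).eventually_lt_const (by norm_num))
  obtain ⟨M0, hM0⟩ := Filter.eventually_atTop.1 hev
  refine ⟨2 * (w + d + 2), (M0 + p0 + 3)!, fun X hX => ?_⟩
  -- choose `m`
  obtain ⟨m, hm1, hm2⟩ : ∃ m, m ! ≤ X ∧ X < (m+1)! := by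
    have hex : ∃ j, X < j ! := ⟨X + 3, by
      have := Nat.lt_factorial_self (n := X+3) (by omega)
      omega⟩
    classical
    have hs := Nat.find_spec hex
    have hpos : Nat.find hex ≠ 0 := by
      intro h0
      rw [h0] at hs
      have := Nat.factorial_pos (M0 + p0 + 3)
      simp at hs
      omega
    obtain ⟨j, hj⟩ := Nat.exists_eq_succ_of_ne_zero hpos
    refine ⟨j, not_lt.1 (Nat.find_min hex (by omega)), ?_⟩
    rw [hj] at hs
    exact hs
  have hm3 : M0 + p0 + 3 ≤ m := by
    by_contra! hlt
    have := Nat.factorial_le (show m + 1 ≤ M0 + p0 + 3 by omega)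
    omega
  set M := m + 1 with hM
  obtain ⟨p, hp, hp1, hp2⟩ := Nat.exists_prime_lt_and_le_two_mul (E0 * M) (by positivity)
  have hE0M : M ≤ E0 * M := Nat.le_mul_of_pos_left _ (by omega)
  obtain ⟨ha, hb⟩ := hM0 M (by omega)
  set y : ℝ := (M ! : ℝ) with hy
  have hy1 : 1 ≤ y := by rw [hy]; exact_mod_cast Nat.factorial_pos _
  have hy0 : 0 < y := by linarith
  have hXy : (X:ℝ) ≤ y := by rw [hy]; exact_mod_cast hm2.le
  rw [div_lt_iff₀ hy0] at ha hb
  have hcp : c ^ p ≤ 1/2 * y := by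
    refine le_trans ?_ ha.le
    rw [hk1, ← pow_mul]
    exact pow_le_pow_right₀ hc (by rw [mul_assoc]; exact hp2)
  have hpf : y ^ E0 ≤ ((p-1)! : ℝ) := by
    rw [hy]
    have := (factorial_pow_le M E0).trans (Nat.factorial_le (show E0 * M ≤ p - 1 by omega))
    exact_mod_cast this
  refine ⟨p, hp, by omega, ?_, ?_⟩
  · rw [div_le_iff₀ (lt_of_lt_of_le (by positivity) hpf)]
    calc c ^ p * (X:ℝ)^d ≤ (1/2 * y) * y ^ d := by gcongr
      _ = 1/2 * y ^ (d+1) := by ring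
      _ ≤ 1/2 * y ^ E0 := by
        gcongr
        omega
      _ ≤ _ := by gcongr
  · have h1 : ((p * (D+1))! : ℝ) ≤ y ^ (w+1) := by
      have hle : p * (D+1) ≤ w * M := by
        calc p * (D+1) ≤ (2 * (E0 * M)) * (D+1) := by gcongr
          _ = w * M := by rw [hw]; ring
      have h2 : ((p * (D+1))! : ℝ) ≤ ((w * M : ℕ) : ℝ) ^ (w * M) := by
        exact_mod_cast (Nat.factorial_le hle).trans (Nat.factorial_le_pow _)
      have h3 : (M:ℝ) ^ M ≤ Real.exp 1 ^ M * y := by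
        have := Real.pow_div_factorial_le_exp (M:ℝ) (by positivity) M
        rw [div_le_iff₀ hy0] at this
        rw [← Real.exp_nat_mul, mul_one]
        exact this
      calc _ ≤ _ := h2
        _ = ((w:ℝ)^w)^M * ((M:ℝ)^M)^w := by push_cast; ring
        _ ≤ ((w:ℝ)^w)^M * (Real.exp 1 ^ M * y)^w := by gcongr
        _ = k2 ^ M * y ^ w := by rw [hk2]; ring
        _ ≤ y * y ^ w := by gcongr; linarith
        _ = _ := by ring
    have hyX : y ≤ (X:ℝ)^2 := by
      have h4 : M ! ≤ X ^ 2 := by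
        rw [hM, Nat.factorial_succ, sq]
        apply Nat.mul_le_mul _ hm1
        have := Nat.lt_factorial_self (n := m) (by omega)
        omega
      rw [hy]
      exact_mod_cast h4
    calc c ^ p * (p * (D+1))! * (X:ℝ) ^ d ≤ y * y^(w+1) * y^d := by
          gcongr
          linarith
      _ = y ^ (w+d+2) := by ring
      _ ≤ ((X:ℝ)^2) ^ (w+d+2) := by gcongr
      _ = _ := by rw [← pow_mul]

theorem isIntegral_pow_smul_aeval {K : Type*} [Field K] (a : ℤ) (t : K)
    (ht : IsIntegral ℤ ((a:K) * t)) (g : ℤ[X]) (N : ℕ) (hN : g.natDegree ≤ N) :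
    IsIntegral ℤ ((a:K) ^ N * aeval t g) := by
  rw [aeval_eq_sum_range' (Nat.lt_succ_of_le hN), Finset.mul_sum]
  apply IsIntegral.sum
  intro i hi
  have hi' : i ≤ N := by have := Finset.mem_range.1 hi; omega
  have e : (a:K) ^ N * (g.coeff i • t ^ i) =
      (((g.coeff i) * a ^ (N - i) : ℤ) : K) * ((a:K) * t) ^ i := by
    have e2 : (a:K)^N = (a:K)^(N-i) * (a:K)^i := by rw [← pow_add]; congr 1; omega
    rw [e2, zsmul_eq_mul, mul_pow]
    push_cast
    ring
  rw [e]
  have hInt0 : ∀ z : ℤ, IsIntegral ℤ (z : K) := fun z => by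
    simpa using (isIntegral_algebraMap (R := ℤ) (A := K) (x := z))
  exact (hInt0 _).mul (ht.pow i)

theorem exists_annihilator {K : Type*} [Field K] [Algebra ℚ K] [Algebra.IsAlgebraic ℚ K]
    (T : Finset K) :
    ∃ f : ℤ[X], f.eval 0 ≠ 0 ∧ ∀ t ∈ T, t ≠ 0 → aeval t f = 0 := by
  classical
  have h1 : ∀ t : K, ∃ f : ℤ[X], f.eval 0 ≠ 0 ∧ (t ≠ 0 → aeval t f = 0) := by
    intro t
    by_cases ht : t = 0
    · exact ⟨1, by simp, fun h => absurd ht h⟩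
    · have halg : IsAlgebraic ℤ t :=
        (IsFractionRing.isAlgebraic_iff ℤ ℚ K).2 (Algebra.IsAlgebraic.isAlgebraic t)
      obtain ⟨q, hq, hq2⟩ := halg.exists_nonzero_coeff_and_aeval_eq_zero
        (mem_nonZeroDivisors_of_ne_zero ht)
      exact ⟨q, by rwa [← coeff_zero_eq_eval_zero], fun _ => hq2⟩
  choose F hF1 hF2 using h1
  refine ⟨∏ t ∈ T, F t, ?_, ?_⟩
  · rw [eval_prod]
    exact Finset.prod_ne_zero_iff.2 fun t _ => hF1 t
  · intro t ht ht0
    rw [map_prod]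
    exact Finset.prod_eq_zero ht (hF2 t ht0)

theorem core_lower_bound {K : Type*} [Field K] [Algebra ℚ K] [FiniteDimensional ℚ K]
    [IsGalois ℚ K] (emb : K →+* ℂ) (T : Finset K) :
    ∃ c ≥ (1:ℝ), ∃ D p0 : ℕ, ∀ p : ℕ, p.Prime → p0 < p → ∀ q : K → ℤ,
      (∀ t, q t ≠ 0 → t ∈ T) → (∀ (σ : K ≃ₐ[ℚ] K) t, q (σ t) = q t) → ¬ (p:ℤ) ∣ q 0 →
      ∀ W : ℝ, (∀ t, |(q t : ℝ)| ≤ W) →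
        1 ≤ c ^ p * (p * (D+1))! * ‖∑ t ∈ T, (q t : ℂ) * Complex.exp (emb t)‖ +
          c ^ p * W / (p-1)! := by
  classical
  obtain ⟨f, hf0, hfT⟩ := exists_annihilator T
  obtain ⟨a, ha0, haT⟩ := exists_integral_multiples ℤ ℚ T
  obtain ⟨c, hc1, hc⟩ := hermite_approx f hf0
  set D := f.natDegree with hD
  set α : ℝ := |(a:ℝ)| ^ D with hα
  have ha1 : 1 ≤ |(a:ℝ)| := by exact_mod_cast Int.one_le_abs ha0
  have hα1 : 1 ≤ α := one_le_pow₀ ha1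
  set k : ℝ := T.card + 1 with hk
  have hk1 : 1 ≤ k := by rw [hk]; simp
  refine ⟨α * c * k, one_le_mul_of_one_le_of_one_le (one_le_mul_of_one_le_of_one_le hα1 hc1) hk1,
    D, (eval 0 f).natAbs + a.natAbs, ?_⟩
  intro p hp hpgt q hqT hqinv hq0 W hW
  obtain ⟨n, hpn, hnb, gp, hgdeg, hgp⟩ := hc p (by omega) hp
  have h0T : (0:K) ∈ T := hqT 0 (by rintro h; rw [h] at hq0; simp at hq0)
  have hW0 : 0 ≤ W := (abs_nonneg _).trans (hW 0)
  set N := p * D with hN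
  -- the invariant sum is an integer
  set s : K := ∑ t ∈ T, (q t : K) * aeval t gp with hs
  have hsfix : ∀ σ : K ≃ₐ[ℚ] K, σ s = s := by
    intro σ
    have e1 : s = ∑ᶠ t, (q t : K) * aeval t gp := by
      rw [hs, finsum_eq_sum_of_support_subset]
      intro t ht
      apply hqT
      intro h
      simp [h] at ht
    have e2 : σ s = ∑ t ∈ T, (q t : K) * aeval (σ t) gp := by
      rw [hs, map_sum]
      refine Finset.sum_congr rfl fun t _ => ?_
      rw [map_mul, map_intCast]
      congr 1
      exact (aeval_algHom_apply (σ.toAlgHom.restrictScalars ℤ) t gp).symm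
    have e3 : ∑ t ∈ T, (q t : K) * aeval (σ t) gp = ∑ᶠ t, (q t : K) * aeval (σ t) gp := by
      rw [finsum_eq_sum_of_support_subset]
      intro t ht
      apply hqT
      intro h
      simp [h] at ht
    rw [e2, e3, e1, ← finsum_comp_equiv σ.toEquiv (f := fun t => (q t : K) * aeval t gp)]
    refine finsum_congr fun t => ?_
    simp [hqinv]
  obtain ⟨s', hs'⟩ := (IsGalois.mem_range_algebraMap_iff_fixed s).2 hsfix
  have hsint : IsIntegral ℤ ((a:K) ^ N * s) := by
    rw [hs, Finset.mul_sum]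
    apply IsIntegral.sum
    intro t ht
    have hInt0 : IsIntegral ℤ ((q t : ℤ) : K) := by
      simpa using (isIntegral_algebraMap (R := ℤ) (A := K) (x := q t))
    have := isIntegral_pow_smul_aeval a t (by simpa using haT t ht) gp N hgdeg
    rw [mul_left_comm]
    exact hInt0.mul this
  obtain ⟨z, hz⟩ : ∃ z : ℤ, (a:K) ^ N * s = (z : K) := by
    have h1 : IsIntegral ℤ ((a:ℚ) ^ N * s') := by
      have : IsIntegral ℤ (algebraMap ℚ K ((a:ℚ) ^ N * s')) := by
        rw [map_mul, hs']; simpa using hsint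
      exact (isIntegral_algebraMap_iff (algebraMap ℚ K).injective).1 this
    obtain ⟨z, hz⟩ := IsIntegrallyClosed.isIntegral_iff.1 h1
    refine ⟨z, ?_⟩
    have := congrArg (algebraMap ℚ K) hz
    rw [map_mul, hs'] at this
    simpa using this.symm
  -- in ℂ
  have hzC : (a:ℂ) ^ N * ∑ t ∈ T, (q t : ℂ) * aeval (emb t) gp = (z:ℂ) := by
    have := congrArg emb hz
    rw [map_mul, hs, map_sum] at this
    simp only [map_mul, map_pow, map_intCast] at this
    rw [← this]
    congr 1
    refine Finset.sum_congr rfl fun t _ => ?_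
    congr 1
    exact aeval_algHom_apply (emb.toIntAlgHom) t gp
  set V : ℂ := ∑ t ∈ T, (q t : ℂ) * Complex.exp (emb t) with hV
  set z' : ℤ := a ^ N * n * q 0 + p * (z - a ^ N * q 0 * gp.eval 0) with hz'
  have hz'0 : z' ≠ 0 := by
    intro h0
    have hpp : Prime (p:ℤ) := Nat.prime_iff_prime_int.1 hp
    have h1 : (p:ℤ) ∣ a ^ N * n * q 0 := by
      have h2 : a ^ N * n * q 0 = p * (-(z - a ^ N * q 0 * gp.eval 0)) := by
        rw [hz'] at h0; linarith
      rw [h2]; exact dvd_mul_right _ _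
    rcases hpp.dvd_or_dvd h1 with h1 | h1
    · rcases hpp.dvd_or_dvd h1 with h1 | h1
      · have h3 := hpp.dvd_of_dvd_pow h1
        have := Nat.le_of_dvd (Int.natAbs_pos.2 ha0) (Int.natCast_dvd.1 h3)
        omega
      · exact hpn h1
    · exact hq0 h1
  have herr : ‖(n:ℂ) * V - (n * q 0 + p * (∑ t ∈ T, (q t : ℂ) * aeval (emb t) gp -
      q 0 * gp.eval 0))‖ ≤ T.card * (W * (c ^ p / (p-1)!)) := by
    have hg0 : aeval (emb 0) gp = ((gp.eval 0 : ℤ) : ℂ) := by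
      rw [map_zero, ← eq_intCast (algebraMap ℤ ℂ), ← aeval_algebraMap_apply_eq_algebraMap_eval,
        map_zero]
    have e : (n:ℂ) * V - (n * q 0 + p * (∑ t ∈ T, (q t : ℂ) * aeval (emb t) gp -
        q 0 * gp.eval 0)) =
        ∑ t ∈ T.erase 0, (q t : ℂ) * (n * Complex.exp (emb t) - p * aeval (emb t) gp) := by
      rw [hV, ← Finset.add_sum_erase T _ h0T, ← Finset.add_sum_erase T _ h0T, hg0, map_zero,
        Complex.exp_zero]
      have : ∑ t ∈ T.erase 0, (q t : ℂ) * (n * Complex.exp (emb t) - p * aeval (emb t) gp) =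
          n * ∑ t ∈ T.erase 0, (q t : ℂ) * Complex.exp (emb t) -
          p * ∑ t ∈ T.erase 0, (q t : ℂ) * aeval (emb t) gp := by
        rw [Finset.mul_sum, Finset.mul_sum, ← Finset.sum_sub_distrib]
        refine Finset.sum_congr rfl fun t _ => ?_
        ring
      rw [this]
      ring
    rw [e]
    refine (norm_sum_le _ _).trans ?_
    calc _ ≤ ∑ t ∈ T.erase 0, W * (c ^ p / (p-1)!) := by
          refine Finset.sum_le_sum fun t ht => ?_
          obtain ⟨ht0, htT⟩ := Finset.mem_erase.1 ht
          rw [norm_mul]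
          have h1 : ‖(q t : ℂ)‖ ≤ W := by
            rw [Complex.norm_intCast]; exact hW t
          have h2 := hgp (emb t) (by
            have := congrArg emb (hfT t htT ht0)
            rw [map_zero] at this
            rw [← this]
            exact aeval_algHom_apply (emb.toIntAlgHom) t f)
          gcongr
      _ = (T.erase 0).card * (W * (c ^ p / (p-1)!)) := by
          rw [Finset.sum_const, nsmul_eq_mul]
      _ ≤ _ := by
          gcongr
          exact Finset.erase_subset _ _
  have hz'C : (z' : ℂ) = (a:ℂ)^N * (n * q 0 + p * (∑ t ∈ T, (q t : ℂ) * aeval (emb t) gp -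
      q 0 * gp.eval 0)) := by
    rw [hz']
    push_cast
    rw [← hzC]
    ring
  have h1 : (1:ℝ) ≤ ‖(z':ℂ)‖ := by
    rw [Complex.norm_intCast]
    exact_mod_cast Int.one_le_abs hz'0
  have haN : ‖(a:ℂ)^N‖ = α ^ p := by
    rw [norm_pow, Complex.norm_intCast, hα, hN, ← pow_mul, mul_comm]
  have h2 : ‖(z':ℂ)‖ ≤ α ^ p * (|(n:ℝ)| * ‖V‖ + T.card * (W * (c ^ p / (p-1)!))) := by
    rw [hz'C, norm_mul, haN]
    gcongr
    calc _ = ‖(n:ℂ) * V - ((n:ℂ) * V - (n * q 0 + p * (∑ t ∈ T, (q t : ℂ) * aeval (emb t) gp -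
              q 0 * gp.eval 0)))‖ := by rw [sub_sub_cancel]
      _ ≤ _ := (norm_sub_le _ _).trans (by
          gcongr
          rw [norm_mul, Complex.norm_intCast])
  have hkp : k ≤ k ^ p := le_self_pow₀ hk1 hp.ne_zero
  have hTk : (T.card : ℝ) ≤ k ^ p := by
    refine le_trans ?_ hkp
    rw [hk]; linarith
  calc 1 ≤ _ := h1.trans h2
    _ ≤ α ^ p * ((c ^ p * (p * (D+1))!) * ‖V‖ + k ^ p * (W * (c ^ p / (p-1)!))) := by
        gcongr
    _ = (α * c) ^ p * 1 * (p * (D+1))! * ‖V‖ + (α * c * k) ^ p * W / (p-1)! := by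
        rw [mul_pow, mul_pow, mul_pow]; ring
    _ ≤ _ := by
        rw [mul_pow (α * c)]
        gcongr
        exact one_le_pow₀ hk1

open AddMonoidAlgebra in
/-- The formal sum `A [0] + B [u] + B [-u]`. -/
def ell {K : Type*} [Field K] (A B : ℤ) (u : K) : AddMonoidAlgebra ℤ K :=
  single 0 A + single u B + single (-u) B

theorem coeff_ell_mul {K : Type*} [Field K] (A B : ℤ) (u : K) (x : AddMonoidAlgebra ℤ K) (t : K) :
    (ell A B u * x).coeff t = A * x.coeff t + B * x.coeff (-u + t) + B * x.coeff (u + t) := by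
  simp [ell, add_mul, AddMonoidAlgebra.coeff_single_mul_apply]

/-- Evaluation `[t] ↦ exp (emb t)`. -/
def evExp {K : Type*} [Field K] (emb : K →+* ℂ) : AddMonoidAlgebra ℤ K →ₐ[ℤ] ℂ :=
  AddMonoidAlgebra.lift ℤ ℂ K
    { toFun := fun t => Complex.exp (emb t.toAdd)
      map_one' := by simp
      map_mul' := fun s t => by simp [Complex.exp_add] }

theorem evExp_eq_sum {K : Type*} [Field K] (emb : K →+* ℂ) (x : AddMonoidAlgebra ℤ K)
    (T : Finset K) (hT : ∀ t, x.coeff t ≠ 0 → t ∈ T) :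
    evExp emb x = ∑ t ∈ T, (x.coeff t : ℂ) * Complex.exp (emb t) := by
  rw [evExp, AddMonoidAlgebra.lift_apply, Finsupp.sum_of_support_subset (s := T)]
  · simp
  · intro t ht
    exact hT t (Finsupp.mem_support_iff.1 ht)
  · simp

theorem evExp_single {K : Type*} [Field K] (emb : K →+* ℂ) (t : K) (b : ℤ) :
    evExp emb (AddMonoidAlgebra.single t b) = b * Complex.exp (emb t) := by
  simp [evExp]

theorem evExp_ell {K : Type*} [Field K] (emb : K →+* ℂ) (A B : ℤ) (u : K) :
    evExp emb (ell A B u) =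
      A + B * (Complex.exp (emb u) + Complex.exp (-emb u)) := by
  rw [ell, map_add, map_add, evExp_single, evExp_single, evExp_single]
  simp
  ring

theorem prod_ell_bound {K ι : Type*} [Field K] [DecidableEq K] (A B : ℤ) (u : ι → K)
    (U : Finset K) (h0 : 0 ∈ U) (h1 : ∀ i, u i ∈ U) (h2 : ∀ i, - u i ∈ U) (s : Finset ι) :
    (∀ t, (∏ i ∈ s, ell A B (u i)).coeff t ≠ 0 → 
        ∃ l : List K, l.length = s.card ∧ (∀ y ∈ l, y ∈ U) ∧ l.sum = t) ∧
    (∀ t, |(((∏ i ∈ s, ell A B (u i)).coeff t : ℤ) : ℝ)| ≤ (|(A:ℝ)| + 2 * |(B:ℝ)|) ^ s.card) := by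
  classical
  induction s using Finset.induction_on with
  | empty =>
    constructor
    · intro t ht
      refine ⟨[], rfl, by simp, ?_⟩
      by_contra hne
      apply ht
      simp only [Finset.prod_empty, AddMonoidAlgebra.one_def, AddMonoidAlgebra.coeff_single]
      exact Finsupp.single_eq_of_ne (Ne.symm (by simpa using hne))
    · intro t
      simp only [Finset.prod_empty, AddMonoidAlgebra.one_def, AddMonoidAlgebra.coeff_single,
        Finsupp.single_apply]
      split_ifs <;> simp
  | insert i s hi ih =>
    obtain ⟨ih1, ih2⟩ := ih
    rw [Finset.prod_insert hi, Finset.card_insert_of_notMem hi]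
    set x := ∏ i ∈ s, ell A B (u i)
    constructor
    · intro t ht
      rw [coeff_ell_mul] at ht
      have hex : ∃ y ∈ U, x.coeff (-y + t) ≠ 0 := by
        by_contra! hall
        apply ht
        have e1 := hall 0 h0
        have e2 := hall _ (h1 i)
        have e3 := hall _ (h2 i)
        rw [neg_zero, zero_add] at e1
        rw [neg_neg] at e3
        rw [e1, e2, e3]
        simp
      obtain ⟨y, hy, hxy⟩ := hex
      obtain ⟨l, hl1, hl2, hl3⟩ := ih1 _ hxy
      refine ⟨y :: l, by simp [hl1], ?_, by simp [hl3]⟩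
      intro z hz
      rcases List.mem_cons.1 hz with rfl | hz
      · exact hy
      · exact hl2 z hz
    · intro t
      rw [coeff_ell_mul]
      push_cast
      have e1 := ih2 t
      have e2 := ih2 (-u i + t)
      have e3 := ih2 (u i + t)
      set H := (|(A:ℝ)| + 2 * |(B:ℝ)|)
      calc _ ≤ |(A:ℝ) * x.coeff t| + |(B:ℝ) * x.coeff (-u i + t)| + |(B:ℝ) * x.coeff (u i + t)| :=
            (abs_add_le _ _).trans (by gcongr; exact abs_add_le _ _)
        _ ≤ |(A:ℝ)| * H ^ s.card + |(B:ℝ)| * H ^ s.card + |(B:ℝ)| * H ^ s.card := by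
            rw [abs_mul, abs_mul, abs_mul]
            gcongr
        _ = H ^ (s.card + 1) := by
            have : H ^ (s.card+1) = H ^ s.card * (|(A:ℝ)| + 2 * |(B:ℝ)|) := pow_succ _ _
            rw [this]
            ring

theorem prod_ell_mod {K ι : Type*} [Field K] [CharZero K] (A B : ℤ) (u : ι → K)
    (hu : ∀ i, u i ≠ 0) (s : Finset ι) (p : ℕ) (hp : p.Prime)
    (hAB : ¬ ((p:ℤ) ∣ A ∧ (p:ℤ) ∣ B)) :
    ∃ t, ¬ (p:ℤ) ∣ (∏ i ∈ s, ell A B (u i)).coeff t := by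
  haveI := Fact.mk hp
  by_contra! hall
  set ψ := AddMonoidAlgebra.mapRingHom K (Int.castRingHom (ZMod p)) with hψ
  have hz : ψ (∏ i ∈ s, ell A B (u i)) = 0 := by
    ext t
    rw [hψ, AddMonoidAlgebra.coeff_mapRingHom]
    simpa [ZMod.intCast_zmod_eq_zero_iff_dvd] using hall t
  rw [map_prod, Finset.prod_eq_zero_iff] at hz
  obtain ⟨i, -, hi⟩ := hz
  have hne : u i ≠ - u i := by
    intro h
    exact hu i (self_eq_neg.1 h)
  have hc : ∀ t, (p:ℤ) ∣ (ell A B (u i)).coeff t := by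
    intro t
    have : (ψ (ell A B (u i))).coeff t = 0 := by rw [hi]; simp
    rw [hψ, AddMonoidAlgebra.coeff_mapRingHom] at this
    simpa [ZMod.intCast_zmod_eq_zero_iff_dvd] using this
  apply hAB
  constructor
  · have := hc 0
    simpa [ell, Finsupp.single_apply, hu i] using this
  · have := hc (u i)
    simpa [ell, Finsupp.single_apply, hu i, (hu i).symm, hne, hne.symm] using this

theorem rearrange (H Θ M Ω c : ℝ) (g : ℕ) :
    (H * Θ) ^ g * M * (c * Ω) = c * (Θ ^ g * Ω) * H ^ g * M := by
  rw [mul_pow]; ring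

set_option maxHeartbeats 1000000 in
theorem exists_invariant {K : Type*} [Field K] [Algebra ℚ K] [FiniteDimensional ℚ K]
    (emb : K →+* ℂ) (u : K) (hu : u ≠ 0) :
    ∃ T : Finset K, ∃ C ≥ (1:ℝ), ∃ d p1 : ℕ, ∀ p : ℕ, p.Prime → p1 < p → ∀ A B : ℤ,
      ¬ ((p:ℤ) ∣ A ∧ (p:ℤ) ∣ B) →
      ∃ q : K → ℤ, (∀ t, q t ≠ 0 → t ∈ T) ∧ (∀ (σ : K ≃ₐ[ℚ] K) t, q (σ t) = q t) ∧
        ¬ (p:ℤ) ∣ q 0 ∧ (∀ t, |(q t : ℝ)| ≤ C * (|(A:ℝ)| + 2 * |(B:ℝ)|) ^ d) ∧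
        ‖∑ t ∈ T, (q t : ℂ) * Complex.exp (emb t)‖ ≤ C * (|(A:ℝ)| + 2 * |(B:ℝ)|) ^ d *
          ‖(A:ℂ) + B * (Complex.exp (emb u) + Complex.exp (-emb u))‖ := by
  classical
  haveI : CharZero K := algebraRat.charZero K
  set g := Fintype.card (K ≃ₐ[ℚ] K) with hg
  set U : Finset K := insert 0 (Finset.univ.image (fun σ : K ≃ₐ[ℚ] K => σ u) ∪
    Finset.univ.image (fun σ : K ≃ₐ[ℚ] K => - σ u)) with hU
  have hSfin : {t : K | ∃ l : List K, l.length = g ∧ (∀ y ∈ l, y ∈ U) ∧ l.sum = t}.Finite := by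
    have h1 : {l : List K | l.length = g ∧ ∀ y ∈ l, y ∈ U}.Finite := by
      have := List.finite_length_eq U g
      refine (this.image (List.map Subtype.val)).subset ?_
      rintro l ⟨hl, hl2⟩
      refine ⟨l.attachWith _ hl2, ?_, ?_⟩
      · simpa using hl
      · simp
    refine (h1.image List.sum).subset ?_
    rintro t ⟨l, hl1, hl2, hl3⟩
    exact ⟨l, ⟨hl1, hl2⟩, hl3⟩
  set S : Finset K := hSfin.toFinset with hS
  set T : Finset K := (S ×ˢ S).image (fun x => x.1 - x.2) with hT
  -- constants
  set Θ : ℝ := 1 + ∑ σ : K ≃ₐ[ℚ] K, Real.exp ‖emb (σ u)‖ with hΘ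
  have hΘ1 : 1 ≤ Θ := by
    rw [hΘ]
    have : 0 ≤ ∑ σ : K ≃ₐ[ℚ] K, Real.exp ‖emb (σ u)‖ :=
      Finset.sum_nonneg fun _ _ => (Real.exp_pos _).le
    linarith
  set Ω : ℝ := 1 + ∑ t ∈ S, Real.exp ‖emb t‖ with hΩ
  have hΩ1 : 1 ≤ Ω := by
    rw [hΩ]
    have : 0 ≤ ∑ t ∈ S, Real.exp ‖emb t‖ :=
      Finset.sum_nonneg fun _ _ => (Real.exp_pos _).le
    linarith
  have hg1 : 1 ≤ g := Fintype.card_pos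
  have hg1' : (1:ℝ) ≤ g := by exact_mod_cast hg1
  refine ⟨T, g * (Θ ^ g * Ω), ?_, g, g, ?_⟩
  · exact one_le_mul_of_one_le_of_one_le hg1'
      (one_le_mul_of_one_le_of_one_le (one_le_pow₀ hΘ1) hΩ1)
  intro p hp hpg A B hAB
  set H : ℝ := |(A:ℝ)| + 2 * |(B:ℝ)| with hH
  have hH0 : 0 ≤ H := by positivity
  have hH1 : 1 ≤ H := by
    by_contra! hlt
    have hA : A = 0 := by
      by_contra hA
      have : (1:ℝ) ≤ |(A:ℝ)| := by exact_mod_cast Int.one_le_abs hA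
      have := abs_nonneg (B:ℝ)
      linarith
    have hB : B = 0 := by
      by_contra hB
      have : (1:ℝ) ≤ |(B:ℝ)| := by exact_mod_cast Int.one_le_abs hB
      have := abs_nonneg (A:ℝ)
      linarith
    exact hAB ⟨by simp [hA], by simp [hB]⟩
  set P : AddMonoidAlgebra ℤ K := ∏ σ : K ≃ₐ[ℚ] K, ell A B (σ u) with hP
  obtain ⟨hPS, hPb⟩ := prod_ell_bound A B (fun σ : K ≃ₐ[ℚ] K => σ u) U (by simp [hU])
    (fun σ => by simp [hU]) (fun σ => by simp [hU]) Finset.univ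
  rw [Finset.card_univ, ← hg] at hPS hPb
  have hPS' : ∀ t, P.coeff t ≠ 0 → t ∈ S := fun t ht => by
    rw [hS, Set.Finite.mem_toFinset]; exact hPS t ht
  -- invariance
  have hPinv : ∀ (σ : K ≃ₐ[ℚ] K) t, P.coeff (σ t) = P.coeff t := by
    intro σ t
    have e : AddMonoidAlgebra.mapDomainRingHom ℤ (σ : K →+ K) P = P := by
      rw [hP, map_prod]
      refine Fintype.prod_equiv (Equiv.mulLeft σ) _ _ fun τ => ?_
      simp [ell, AddMonoidAlgebra.mapDomain_add]
    have e2 : (AddMonoidAlgebra.mapDomainRingHom ℤ (σ : K →+ K) P).coeff (σ t) = P.coeff t := by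
      simp only [AddMonoidAlgebra.mapDomainRingHom_apply, AddMonoidAlgebra.coeff_mapDomain]
      exact Finsupp.mapDomain_apply σ.injective _ _
    rw [← e2, e]
  obtain ⟨δ, hδ⟩ := prod_ell_mod A B (fun σ : K ≃ₐ[ℚ] K => σ u) (fun σ => by simpa using hu)
    Finset.univ p hp hAB
  change ¬ (p:ℤ) ∣ P.coeff δ at hδ
  have hδ0 : P.coeff δ ≠ 0 := by rintro h; rw [h] at hδ; simp at hδ
  set Z : AddMonoidAlgebra ℤ K := ∑ σ : K ≃ₐ[ℚ] K, AddMonoidAlgebra.single (-(σ δ)) 1 with hZ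
  have hQ : ∀ t, (P * Z).coeff t = ∑ σ : K ≃ₐ[ℚ] K, P.coeff (t + σ δ) := by
    intro t
    rw [hZ, Finset.mul_sum, AddMonoidAlgebra.coeff_sum, Finsupp.finsetSum_apply]
    refine Finset.sum_congr rfl fun σ _ => ?_
    simp
  have hQT : ∀ t, (P * Z).coeff t ≠ 0 → t ∈ T := by
    intro t ht
    rw [hQ] at ht
    obtain ⟨σ, -, hσ⟩ := Finset.exists_ne_zero_of_sum_ne_zero ht
    rw [hT, Finset.mem_image]
    refine ⟨(t + σ δ, σ δ), Finset.mem_product.2 ⟨hPS' _ hσ, hPS' _ ?_⟩, by simp⟩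
    rwa [hPinv]
  refine ⟨fun t => (P * Z).coeff t, hQT, ?_, ?_, ?_, ?_⟩
  · intro σ t
    simp only [hQ]
    symm
    refine Fintype.sum_equiv (Equiv.mulLeft σ) _ _ fun τ => ?_
    rw [← hPinv σ]
    simp
  · simp only [hQ, zero_add, hPinv]
    rw [Finset.sum_const, Finset.card_univ, ← hg, nsmul_eq_mul]
    intro hdvd
    rcases (Nat.prime_iff_prime_int.1 hp).dvd_or_dvd hdvd with h | h
    · have := Nat.le_of_dvd (by omega) (Int.natCast_dvd_natCast.1 h)
      omega
    · exact hδ h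
  · intro t
    simp only [hQ]
    push_cast
    calc _ ≤ ∑ σ : K ≃ₐ[ℚ] K, |(P.coeff (t + σ δ) : ℝ)| := Finset.abs_sum_le_sum_abs _ _
      _ ≤ ∑ σ : K ≃ₐ[ℚ] K, H ^ g := Finset.sum_le_sum fun σ _ => hPb _
      _ = g * 1 * H ^ g := by rw [Finset.sum_const, Finset.card_univ, ← hg, nsmul_eq_mul, mul_one]
      _ ≤ _ := by
        gcongr
        exact one_le_mul_of_one_le_of_one_le (one_le_pow₀ hΘ1) hΩ1
  · rw [← evExp_eq_sum emb (P * Z) T hQT, map_mul, norm_mul]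
    have hZb : ‖evExp emb Z‖ ≤ g * Ω := by
      rw [hZ, map_sum]
      refine (norm_sum_le _ _).trans ?_
      calc _ ≤ ∑ σ : K ≃ₐ[ℚ] K, Ω := by
            refine Finset.sum_le_sum fun σ _ => ?_
            rw [evExp_single, Int.cast_one, one_mul, Complex.norm_exp]
            have hmem : -(-(σ δ)) ∈ S := by
              rw [neg_neg]; exact hPS' _ (by rwa [hPinv])
            have h3 := Finset.single_le_sum (f := fun t => Real.exp ‖emb t‖)
              (fun _ _ => (Real.exp_pos _).le) hmem
            have h4 : Real.exp (emb (-(σ δ))).re ≤ Real.exp ‖emb (-(-(σ δ)))‖ := by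
              apply Real.exp_le_exp.2
              rw [map_neg emb (-(σ δ)), norm_neg]
              exact Complex.re_le_norm _
            rw [hΩ]
            linarith
        _ = _ := by rw [Finset.sum_const, Finset.card_univ, ← hg, nsmul_eq_mul]
    have hfac : ∀ σ : K ≃ₐ[ℚ] K, ‖evExp emb (ell A B (σ u))‖ ≤ H * Θ := by
      intro σ
      rw [evExp_ell]
      have h3 := Finset.single_le_sum (f := fun σ : K ≃ₐ[ℚ] K => Real.exp ‖emb (σ u)‖)
              (fun _ _ => (Real.exp_pos _).le) (Finset.mem_univ σ)
      have h4 : ‖Complex.exp (emb (σ u))‖ ≤ Θ := by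
        rw [Complex.norm_exp]
        have := Real.exp_le_exp.2 (Complex.re_le_norm (emb (σ u)))
        rw [hΘ]; linarith
      have h5 : ‖Complex.exp (-emb (σ u))‖ ≤ Θ := by
        rw [Complex.norm_exp]
        have := Real.exp_le_exp.2 (Complex.re_le_norm (-emb (σ u)))
        rw [norm_neg] at this
        rw [hΘ]; linarith
      calc _ ≤ ‖(A:ℂ)‖ + ‖(B:ℂ)‖ * (‖Complex.exp (emb (σ u))‖ + ‖Complex.exp (-emb (σ u))‖) := by
            refine (norm_add_le _ _).trans ?_
            rw [norm_mul]
            gcongr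
            exact norm_add_le _ _
        _ ≤ |(A:ℝ)| * Θ + |(B:ℝ)| * (Θ + Θ) := by
            rw [Complex.norm_intCast, Complex.norm_intCast]
            gcongr
            exact le_mul_of_one_le_right (abs_nonneg _) hΘ1
        _ = _ := by rw [hH]; ring
    have hPe : ‖evExp emb P‖ ≤ (H * Θ) ^ g *
        ‖(A:ℂ) + B * (Complex.exp (emb u) + Complex.exp (-emb u))‖ := by
      rw [hP, map_prod, norm_prod, ← Finset.prod_erase_mul _ _ (Finset.mem_univ (1 : K ≃ₐ[ℚ] K))]
      rw [AlgEquiv.one_apply, evExp_ell]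
      gcongr
      have hHΘ : 1 ≤ H * Θ := one_le_mul_of_one_le_of_one_le hH1 hΘ1
      calc _ ≤ ∏ σ ∈ Finset.univ.erase (1 : K ≃ₐ[ℚ] K), (H * Θ) :=
            Finset.prod_le_prod (fun _ _ => norm_nonneg _) fun σ _ => hfac σ
        _ = (H * Θ) ^ (Finset.univ.erase (1 : K ≃ₐ[ℚ] K)).card := by rw [Finset.prod_const]
        _ ≤ (H * Θ) ^ g := pow_le_pow_right₀ hHΘ (by
            rw [hg]; exact Finset.card_le_univ _)
    have hfin := mul_le_mul hPe hZb (norm_nonneg _)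
      (mul_nonneg (pow_nonneg (mul_nonneg hH0 (zero_le_one.trans hΘ1)) _) (norm_nonneg _))
    exact hfin.trans_eq (rearrange _ _ _ _ _ _)

theorem linear_form_bound (γ : ℂ) (hγ : γ ≠ 0) (halg : IsAlgebraic ℚ γ) :
    ∃ E X0 : ℕ, ∀ X : ℕ, X0 ≤ X → ∀ A B : ℤ,
      (∀ p : ℕ, p.Prime → 2 < p → ¬ ((p:ℤ) ∣ A ∧ (p:ℤ) ∣ B)) →
      |(A:ℝ)| + 2 * |(B:ℝ)| ≤ X →
      1 / 2 ≤ (X:ℝ) ^ E * ‖(A:ℂ) + B * (Complex.exp γ + Complex.exp (-γ))‖ := by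
  set K := IntermediateField.adjoin ℚ ((minpoly ℚ γ).rootSet ℂ) with hK
  haveI hsf : (minpoly ℚ γ).IsSplittingField ℚ K :=
    IntermediateField.adjoin_rootSet_isSplittingField (IsAlgClosed.splits _)
  haveI : FiniteDimensional ℚ K := Polynomial.IsSplittingField.finiteDimensional K (minpoly ℚ γ)
  haveI : Normal ℚ K := Normal.of_isSplittingField (minpoly ℚ γ)
  haveI : IsGalois ℚ K := ⟨⟩
  have hmem : γ ∈ K := by
    apply IntermediateField.subset_adjoin
    rw [mem_rootSet]
    exact ⟨minpoly.ne_zero halg.isIntegral, minpoly.aeval ℚ γ⟩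
  set u : K := ⟨γ, hmem⟩ with hu
  set emb : K →+* ℂ := algebraMap K ℂ with hemb
  have hembu : emb u = γ := rfl
  have hu0 : u ≠ 0 := by
    intro h
    apply hγ
    rw [← hembu, h, map_zero]
  obtain ⟨T, C, hC1, d, p1, hinv⟩ := exists_invariant emb u hu0
  obtain ⟨c, hc1, D, p0, hcore⟩ := core_lower_bound emb T
  obtain ⟨E, X0, hch⟩ := choose_prime (c * C) (one_le_mul_of_one_le_of_one_le hc1 hC1) d D
    (p0 + p1 + 2)
  refine ⟨E, X0, fun X hX A B hAB hH => ?_⟩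
  obtain ⟨p, hp, hpgt, hs1, hs2⟩ := hch X hX
  obtain ⟨q, hq1, hq2, hq3, hq4, hq5⟩ := hinv p hp (by omega) A B (hAB p hp (by omega))
  have hfin := hcore p hp (by omega) q hq1 hq2 hq3 _ hq4
  rw [hembu] at hq5
  set V := ‖∑ t ∈ T, (q t : ℂ) * Complex.exp (emb t)‖
  set M := ‖(A:ℂ) + B * (Complex.exp γ + Complex.exp (-γ))‖
  set H := |(A:ℝ)| + 2 * |(B:ℝ)|
  have hH0 : 0 ≤ H := by positivity
  have hC0 : 0 ≤ C := by linarith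
  have hCp : C ≤ C ^ p := le_self_pow₀ hC1 hp.ne_zero
  have hc0 : 0 ≤ c := by linarith
  have hM0 : 0 ≤ M := norm_nonneg _
  have t1 : c ^ p * (C * H ^ d) / (p-1)! ≤ 1/2 := by
    refine le_trans ?_ hs1
    rw [mul_pow, mul_assoc (c^p)]
    gcongr
  have t2 : c ^ p * (p * (D+1))! * V ≤ (X:ℝ)^E * M := by
    calc _ ≤ c ^ p * (p * (D+1))! * (C ^ p * (X:ℝ) ^ d * M) := by
          gcongr
          refine hq5.trans ?_
          gcongr
      _ = ((c * C) ^ p * (p * (D+1))! * (X:ℝ)^d) * M := by rw [mul_pow]; ring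
      _ ≤ _ := by gcongr
  linarith

theorem sin_not_liouville (β : ℝ) (hβ : β ≠ 0) (halg : IsAlgebraic ℚ β) :
    ¬ Liouville (Real.sin β) := by
  intro hL
  set γ : ℂ := 2 * Complex.I * β with hγ
  have hγ0 : γ ≠ 0 := by simp [hγ, hβ]
  have hγalg : IsAlgebraic ℚ γ := by
    have h1 : IsAlgebraic ℚ (β : ℂ) := halg.algebraMap (A := ℂ)
    have h2 : IsAlgebraic ℚ Complex.I := by
      refine ⟨X ^ 2 + 1, ?_, by simp⟩
      exact (monic_X_pow_add_C (R := ℚ) 1 (two_ne_zero)).ne_zero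
    have h3 : IsAlgebraic ℚ (2:ℂ) := by exact_mod_cast isAlgebraic_natCast (R := ℚ) (A := ℂ) 2
    exact (h3.mul h2).mul h1
  obtain ⟨E, X0, hbound⟩ := linear_form_bound γ hγ0 hγalg
  obtain ⟨b, ⟨a, hne, hlt⟩, hb⟩ := ((hL.frequently_exists_num (3 * E + 8)).and_eventually
    (Filter.eventually_ge_atTop (X0 + 21))).exists
  set s := Real.sin β with hs
  have hs1 : |s| ≤ 1 := Real.abs_sin_le_one β
  set r : ℚ := (a:ℚ) / (b:ℚ) with hr
  have hrR : (r:ℝ) = (a:ℝ) / b := by rw [hr]; push_cast; rfl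
  rw [← hrR] at hlt
  have hb21 : (21:ℝ) ≤ b := by exact_mod_cast (by omega : 21 ≤ b)
  have hb0 : (0:ℝ) < b := by linarith
  have hden : r.den ≤ b := by
    have h1 : (r.den : ℤ) ∣ (b:ℤ) := by
      have := Rat.den_dvd a (b:ℤ)
      simpa [Rat.divInt_eq_div, hr] using this
    exact Nat.le_of_dvd (by omega) (Int.natCast_dvd_natCast.1 h1)
  set P : ℤ := r.num
  set Q : ℕ := r.den
  have hQ0 : (0:ℝ) < Q := by exact_mod_cast r.den_pos
  have hQb : (Q:ℝ) ≤ b := by exact_mod_cast hden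
  have hrPQ : (r:ℝ) * Q = P := by
    have := Rat.mul_den_eq_num r
    exact_mod_cast this
  have hpow1 : 1 / (b:ℝ) ^ (3 * E + 8) ≤ 1 := by
    rw [div_le_one (by positivity)]
    exact one_le_pow₀ (by linarith)
  have hr2 : |(r:ℝ)| ≤ 2 := by
    have h1 := abs_sub_abs_le_abs_sub (r:ℝ) s
    rw [abs_sub_comm] at h1
    linarith
  have hP2 : |(P:ℝ)| ≤ 2 * Q := by
    rw [← hrPQ, abs_mul, abs_of_pos hQ0]
    gcongr
  set A : ℤ := 4 * P ^ 2 - 2 * (Q:ℤ) ^ 2 with hA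
  set B : ℤ := (Q:ℤ) ^ 2 with hB
  have hcop : ∀ p : ℕ, p.Prime → 2 < p → ¬ ((p:ℤ) ∣ A ∧ (p:ℤ) ∣ B) := by
    rintro p hp hp2 ⟨h1, h2⟩
    have hpp := Nat.prime_iff_prime_int.1 hp
    have hQ : (p:ℤ) ∣ Q := hpp.dvd_of_dvd_pow h2
    have h3 : (p:ℤ) ∣ 4 * P ^ 2 := by
      have : 4 * P ^ 2 = A + 2 * B := by rw [hA, hB]; ring
      rw [this]
      exact dvd_add h1 (Dvd.dvd.mul_left h2 2)
    have hP : (p:ℤ) ∣ P := by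
      rcases hpp.dvd_or_dvd h3 with h4 | h4
      · exfalso
        have h5 : (p:ℤ) ∣ 2 ^ 2 := by norm_num; exact h4
        have h6 := hpp.dvd_of_dvd_pow h5
        have := Int.le_of_dvd (by norm_num) h6
        omega
      · exact hpp.dvd_of_dvd_pow h4
    have hc := r.reduced
    have h7 : p ∣ P.natAbs := Int.natCast_dvd.1 hP
    have h8 : p ∣ Q := Int.natCast_dvd_natCast.1 hQ
    have h9 := Nat.dvd_gcd h7 h8
    rw [Nat.Coprime.gcd_eq_one hc] at h9
    exact hp.one_lt.ne' (Nat.dvd_one.1 h9)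
  have hP2' : (P:ℝ)^2 ≤ 4 * (Q:ℝ)^2 := by
    have := pow_le_pow_left₀ (abs_nonneg _) hP2 2
    rw [sq_abs] at this
    linarith
  have hQQ : (Q:ℝ)^2 ≤ (b:ℝ)^2 := by gcongr
  have hHX : |(A:ℝ)| + 2 * |(B:ℝ)| ≤ ((b ^ 3 : ℕ) : ℝ) := by
    have h1 : |(A:ℝ)| ≤ 18 * (Q:ℝ)^2 := by
      have hBR : (B:ℝ) = (Q:ℝ)^2 := by rw [hB]; push_cast; rfl
      rw [hA]; push_cast
      rw [hBR]
      rw [abs_le]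
      constructor <;> nlinarith [sq_nonneg (P:ℝ), sq_nonneg (Q:ℝ)]
    have h2 : |(B:ℝ)| = (Q:ℝ)^2 := by rw [hB]; push_cast; exact abs_of_nonneg (sq_nonneg _)
    rw [h2]; push_cast
    nlinarith [sq_nonneg (b:ℝ)]
  have hX0 : X0 ≤ b ^ 3 := by
    have : b ≤ b ^ 3 := Nat.le_self_pow (by norm_num) b
    omega
  have hmain := hbound (b ^ 3) hX0 A B hcop hHX
  have hval : (A:ℂ) + B * (Complex.exp γ + Complex.exp (-γ)) =
      ((4 * (P^2 - (Q:ℝ)^2 * s^2) : ℝ) : ℂ) := by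
    have e1 : Complex.exp γ + Complex.exp (-γ) = 2 * Complex.cos (2 * β) := by
      rw [Complex.two_cos, hγ]
      congr 2 <;> ring
    rw [e1, Complex.cos_two_mul, Complex.cos_sq', hA, hB, hs]
    push_cast
    ring
  rw [hval, Complex.norm_real, Real.norm_eq_abs] at hmain
  have hfactor : 4 * ((P:ℝ)^2 - (Q:ℝ)^2 * s^2) = -(4 * (Q:ℝ)^2 * ((s - r) * (s + r))) := by
    rw [← hrPQ]; ring
  have hup : |4 * ((P:ℝ)^2 - (Q:ℝ)^2 * s^2)| ≤ 4 * (b:ℝ)^2 * (1 / (b:ℝ) ^ (3 * E + 8) * 3) := by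
    rw [hfactor, abs_neg, abs_mul, abs_mul (s - r), abs_of_nonneg (by positivity : 0 ≤ 4 * (Q:ℝ)^2)]
    have : |s + r| ≤ 3 := (abs_add_le _ _).trans (by linarith)
    gcongr
  have hfin : ((b ^ 3 : ℕ):ℝ) ^ E * (4 * (b:ℝ)^2 * (1 / (b:ℝ) ^ (3 * E + 8) * 3)) =
      12 / (b:ℝ)^6 := by
    push_cast
    rw [← pow_mul, show 3 * E + 8 = 3 * E + 2 + 6 by ring, pow_add, pow_add]
    field_simp
    norm_num
  have h1 : 1/2 ≤ 12 / (b:ℝ)^6 := by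
    rw [← hfin]
    refine hmain.trans ?_
    gcongr
  have h2 : (21:ℝ)^6 ≤ (b:ℝ)^6 := by gcongr
  rw [le_div_iff₀ (by positivity)] at h1
  norm_num at h2
  linarith

end

end LiouvilleArcsin

theorem liouville_arcsin_transcendental (α : ℝ) (h : Liouville α) (hle : |α| ≤ 1) :
    Transcendental ℚ (Real.arcsin α) := by
  intro halg
  have hsin : Real.sin (Real.arcsin α) = α :=
    Real.sin_arcsin (abs_le.1 hle).1 (abs_le.1 hle).2
  refine LiouvilleArcsin.sin_not_liouville _ ?_ halg (by rwa [hsin])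
  intro h0
  rw [h0, Real.sin_zero] at hsin
  exact h.irrational.ne_zero hsin.symm
end

section
/- If α is a Liouville number, then arctan α is transcendental. -/
set_option linter.unusedSectionVars false
open Polynomial
lemma LA.an1 (F : ℂ[X]) (B R : ℝ) (hF : ∀ z : ℂ, ‖z‖ ≤ R → ‖F.eval z‖ ≤ B) (t : ℂ)
    (ht : ‖t‖ ≤ R) :
    ‖Complex.exp t * F.sumIDeriv.eval 0 - F.sumIDeriv.eval t‖
      ≤ R * Real.exp (2 * R) * B := by
  have hR : 0 ≤ R := (norm_nonneg _).trans ht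
  have hB : 0 ≤ B := (norm_nonneg _).trans (hF t ht)
  have h := LindemannWeierstrass.integral_exp_mul_eval F t
  have e : Complex.exp t * F.sumIDeriv.eval 0 - F.sumIDeriv.eval t =
      Complex.exp t * (t * ∫ x in (0:ℝ)..1, Complex.exp (-(x • t)) * F.eval (x • t)) := by
    rw [h, mul_add, mul_neg, ← mul_assoc, ← Complex.exp_add]; simp; ring
  rw [e, norm_mul, norm_mul]
  have h1 : ‖∫ x in (0:ℝ)..1, Complex.exp (-(x • t)) * F.eval (x • t)‖ ≤
      (Real.exp R * B) * |1 - 0| := by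
    apply intervalIntegral.norm_integral_le_of_norm_le_const
    intro x hx
    rw [Set.uIoc_of_le zero_le_one] at hx
    have hxt : ‖x • t‖ ≤ R := by
      rw [norm_smul, Real.norm_of_nonneg hx.1.le]
      nlinarith [hx.2, norm_nonneg t]
    rw [norm_mul]
    gcongr
    · rw [Complex.norm_exp]
      gcongr
      exact (Complex.re_le_norm _).trans (by rwa [norm_neg])
    · exact hF _ hxt
  have h2 : ‖Complex.exp t‖ ≤ Real.exp R := by
    rw [Complex.norm_exp]; gcongr; exact (Complex.re_le_norm _).trans ht
  calc _ ≤ Real.exp R * (R * ((Real.exp R * B) * |1 - 0|)) := by gcongr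
    _ = _ := by rw [two_mul, Real.exp_add]; simp; ring

lemma LA.iter (F : ℂ[X]) (j : ℕ) (z : ℂ) : (derivative^[j] F).eval z =
    iteratedDeriv j (fun z => F.eval z) z := by
  induction j generalizing F with
  | zero => simp
  | succ n ih => 
    rw [iteratedDeriv_succ', Function.iterate_succ_apply, ih]
    congr 1
    ext z
    simp

lemma LA.an2 (F : ℂ[X]) (B : ℝ) (n : ℕ) (hn : F.natDegree ≤ n)
    (hF : ∀ z : ℂ, ‖z‖ ≤ 1 → ‖F.eval z‖ ≤ B) :
    ‖F.sumIDeriv.eval 0‖ ≤ (n + 1).factorial * B := by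
  have hB : 0 ≤ B := (norm_nonneg _).trans (hF 0 (by simp))
  rw [sumIDeriv_apply_of_le hn, eval_finsetSum]
  refine (norm_sum_le _ _).trans ?_
  have : ∀ i ∈ Finset.range (n+1), ‖(derivative^[i] F).eval 0‖ ≤ n.factorial * B := by
    intro i hi
    rw [LA.iter]
    have := Complex.norm_iteratedDeriv_le_of_forall_mem_sphere_norm_le (c := 0) (R := 1) (C := B)
      (f := fun z => F.eval z) i one_pos
      (F.differentiable.diffContOnCl) (fun z hz => hF z (by simpa using (mem_sphere_iff_norm.1 hz).le))
    refine this.trans ?_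
    rw [one_pow, div_one]
    gcongr
    exact Finset.mem_range_succ_iff.1 hi
  refine (Finset.sum_le_card_nsmul _ _ _ this).trans ?_
  rw [Nat.factorial_succ]
  simp
  linarith
/-- The auxiliary polynomial. -/
noncomputable def LA.F {O : Type*} [CommRing O] [DecidableEq O] (T : Finset O) (p : ℕ) (s : O) : O[X] :=
  (X - C s) ^ (p - 1) * ∏ t ∈ T.erase s, (X - C t) ^ p

lemma LA.M_off {O : Type*} [CommRing O] [DecidableEq O] [IsDomain O] (T : Finset O) (p : ℕ) (s t : O)
    (ht : t ∈ T) (hst : t ≠ s) : ((p.factorial : ℕ) : O) ∣ eval t (sumIDeriv (LA.F T p s)) := by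
  obtain ⟨g, -, hg⟩ := aeval_sumIDeriv (A := O) (LA.F T p s) p
  have h : (X - C t) ^ p ∣ (LA.F T p s) := by
    unfold LA.F
    apply Dvd.dvd.mul_left
    exact Finset.dvd_prod_of_mem (fun t => (X - C t) ^ p) (Finset.mem_erase.2 ⟨hst, ht⟩)
  have := hg t (by simpa using h)
  simp only [coe_aeval_eq_eval, nsmul_eq_mul] at this
  exact ⟨_, this⟩

lemma LA.M_diag {O : Type*} [CommRing O] [DecidableEq O] [IsDomain O] (T : Finset O) (p : ℕ)
    (hp : 0 < p) (s : O) : ∃ e : O, eval s (sumIDeriv (LA.F T p s)) =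
      ((p-1).factorial : O) * (∏ t ∈ T.erase s, (s - t)) ^ p + (p.factorial : O) * e := by
  obtain ⟨g, -, hg⟩ := eval_sumIDeriv_of_pos (LA.F T p s) hp
  refine ⟨eval s g, ?_⟩
  rw [hg s rfl]
  simp [eval_prod, Finset.prod_pow]

lemma LA.M_dvd {O : Type*} [CommRing O] [DecidableEq O] [IsDomain O] (T : Finset O) (p : ℕ)
    (hp : 0 < p) (s t : O) (ht : t ∈ T) :
    ((p-1).factorial : O) ∣ eval t (sumIDeriv (LA.F T p s)) := by
  have h0 : ((p-1).factorial : O) ∣ (p.factorial : O) := by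
    exact_mod_cast Nat.cast_dvd_cast (Nat.factorial_dvd_factorial (Nat.sub_le p 1))
  by_cases h : t = s
  · subst h
    obtain ⟨e, he⟩ := LA.M_diag T p hp t
    rw [he]
    exact dvd_add (dvd_mul_right _ _) (h0.mul_right _)
  · exact h0.trans (LA.M_off T p s t ht h)

lemma LA.nonvan {O : Type*} [CommRing O] [DecidableEq O] [IsDedekindDomain O] [CharZero O]
    (T : Finset O) (p : ℕ) (hp : p.Prime) (hu : ¬ IsUnit (p : O)) (N : ℤ) (hN : ¬ (p : ℤ) ∣ N)
    (hdiv : ∀ s ∈ T, ∏ t ∈ T.erase s, (s - t) ∣ (N : O)) (c : O → O)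
    (hc : ∃ t ∈ T, c t ≠ 0) :
    ∃ s ∈ T, ∑ t ∈ T, c t * eval t (sumIDeriv (LA.F T p s)) ≠ 0 := by
  by_contra! H
  set I : Ideal O := Ideal.span (c '' T) with hI
  have hcI : ∀ t ∈ T, c t ∈ I := fun t ht => Ideal.subset_span ⟨t, ht, rfl⟩
  have hI0 : I ≠ ⊥ := by
    obtain ⟨t, ht, h0⟩ := hc
    intro h
    have := hcI t ht
    rw [h] at this
    exact h0 (by simpa using this)
  have hfac : ((p-1).factorial : O) ≠ 0 := by exact_mod_cast Nat.factorial_ne_zero _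
  have hfp : (p.factorial : O) = (p-1).factorial * p := by
    rw [← Nat.mul_factorial_pred hp.ne_zero]; push_cast; ring
  set P : Ideal O := Ideal.span {(p : O)} with hP
  have key : ∀ s ∈ T, c s * (∏ t ∈ T.erase s, (s - t)) ^ p ∈ P * I := by
    intro s hs
    obtain ⟨e, he⟩ := LA.M_diag T p hp.pos s
    have h1 : ∀ t, ∃ f, t ∈ T.erase s → eval t (sumIDeriv (LA.F T p s)) = p.factorial * f := by
      intro t
      by_cases ht : t ∈ T.erase s
      · obtain ⟨f, hf⟩ := LA.M_off T p s t (Finset.mem_of_mem_erase ht) (Finset.ne_of_mem_erase ht)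
        exact ⟨f, fun _ => hf⟩
      · exact ⟨0, fun h => absurd h ht⟩
    choose f hf using h1
    have h2 := H s hs
    rw [← Finset.add_sum_erase _ _ hs, he, Finset.sum_congr rfl (fun t ht => by rw [hf t ht])] at h2
    have h3 : c s * (∏ t ∈ T.erase s, (s - t)) ^ p =
        p * (-(c s * e + ∑ t ∈ T.erase s, c t * f t)) := by
      apply mul_left_cancel₀ hfac
      rw [hfp] at h2
      have : ∑ x ∈ T.erase s, c x * (((p-1).factorial : O) * p * f x) =
        ((p-1).factorial : O) * p * ∑ t ∈ T.erase s, c t * f t := by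
        rw [Finset.mul_sum]; exact Finset.sum_congr rfl (fun _ _ => by ring)
      rw [this] at h2
      linear_combination h2
    rw [h3]
    apply Ideal.mul_mem_mul (Ideal.mem_span_singleton_self _)
    apply I.neg_mem
    apply I.add_mem (I.mul_mem_right _ (hcI s hs))
    exact I.sum_mem (fun t ht => I.mul_mem_right _ (hcI t (Finset.mem_of_mem_erase ht)))
  have hco : IsCoprime (N ^ p) (p : ℤ) := by
    apply IsCoprime.pow_left
    rw [isCoprime_comm]
    exact (Prime.coprime_iff_not_dvd (Nat.prime_iff_prime_int.1 hp)).2 hN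
  obtain ⟨u, v, huv⟩ := hco
  have huv' : (u : O) * N ^ p + v * p = 1 := by exact_mod_cast congrArg (Int.cast : ℤ → O) huv
  have hle : I ≤ P * I := by
    rw [hI, Ideal.span_le, ← hI]
    rintro _ ⟨s, hs, rfl⟩
    have hs : s ∈ T := hs
    obtain ⟨w, hw⟩ := hdiv s hs
    have : c s = (u * w ^ p) * (c s * (∏ t ∈ T.erase s, (s - t)) ^ p) + v * (p * c s) := by
      have e1 : (N : O) ^ p = (∏ t ∈ T.erase s, (s - t)) ^ p * w ^ p := by rw [hw, mul_pow]
      rw [e1] at huv'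
      linear_combination (-c s) * huv'
    show c s ∈ P * I
    rw [this]
    exact (P * I).add_mem ((P * I).mul_mem_left _ (key s hs))
      ((P * I).mul_mem_left _ (Ideal.mul_mem_mul (Ideal.mem_span_singleton_self _) (hcI s hs)))
  have heq : P * I = 1 * I := by rw [one_mul]; exact le_antisymm Ideal.mul_le_right hle
  have := mul_right_cancel₀ hI0 heq
  rw [hP, Ideal.one_eq_top, Ideal.span_singleton_eq_top] at this
  exact hu this

lemma LA.expand {O E ι : Type*} [CommRing O] [IsDomain O] [AddCommGroup E] [UniqueSums E] [Fintype ι]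
    [DecidableEq ι] [DecidableEq E]
    (x y : ι → O) (γ : ι → E) (hx : ∀ i, x i ≠ 0) (hγ : ∀ i, γ i ≠ 0) :
    ∃ t, ∑ ε : ι → Bool with (∑ i, if ε i then γ i else 0) = t,
      (∏ i, if ε i then x i else y i) ≠ 0 := by
  by_contra! H
  have h1 : ∏ i, (AddMonoidAlgebra.single (γ i) (x i) + AddMonoidAlgebra.single 0 (y i)) ≠ (0 : AddMonoidAlgebra O E) := by
    rw [Finset.prod_ne_zero_iff]
    intro i _ h
    have := congrArg (fun f : AddMonoidAlgebra O E => f.coeff (γ i)) h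
    simp [(hγ i).symm, hx i] at this
  apply h1
  have h2 : ∀ i, (AddMonoidAlgebra.single (γ i) (x i) + AddMonoidAlgebra.single 0 (y i) : AddMonoidAlgebra O E) =
      ∑ j : Bool, AddMonoidAlgebra.single (if j then γ i else 0) (if j then x i else y i) := by
    intro i; simp
  simp_rw [h2]
  rw [Finset.prod_univ_sum, Fintype.piFinset_univ]
  have h3 : ∀ ε : ι → Bool, ∏ i, (AddMonoidAlgebra.single (if ε i then γ i else 0) (if ε i then x i else y i) : AddMonoidAlgebra O E)
     = AddMonoidAlgebra.single (∑ i, if ε i then γ i else 0) (∏ i, if ε i then x i else y i) := by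
    intro ε
    rw [AddMonoidAlgebra.prod_single]
  simp_rw [h3]
  ext t
  have := H t
  rw [Finset.sum_filter] at this
  simpa [AddMonoidAlgebra.coeff_sum, Finsupp.single_apply] using this
lemma LA.num (k d p0 : ℕ) (A : ℝ) (hA : 1 ≤ A) : ∃ C : ℕ, ∃ H0 : ℝ, ∀ H ≥ H0, ∃ p : ℕ, p.Prime ∧
    p0 < p ∧ 2 * (H ^ d * A ^ p) < ((p-1).factorial : ℝ) ∧
    2 * (((k * p + 1).factorial : ℝ) * A ^ p * H ^ d) ≤ H ^ C := by
  set c : ℝ := A ^ 4 + Real.exp 1 + (2 * k + 1) with hc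
  have hA4 : 1 ≤ A ^ 4 := one_le_pow₀ hA
  have he : 0 < Real.exp 1 := Real.exp_pos 1
  have hk : (0:ℝ) ≤ k := Nat.cast_nonneg k
  have h1 := (FloorSemiring.tendsto_pow_div_factorial_atTop c).eventually (gt_mem_nhds (show (0:ℝ) < 1/8 by norm_num))
  obtain ⟨n1, hn1⟩ := Filter.eventually_atTop.1 h1
  have hcn : ∀ n ≥ n1, 8 * c ^ n ≤ n.factorial := by
    intro n hn
    have := hn1 n hn
    rw [div_lt_iff₀ (by positivity)] at this
    linarith
  set n0 := n1 + p0 + 5 with hn0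
  refine ⟨(2 * d + 1) * (2 * (6 * k + 6)), n0.factorial + 1, fun H hH => ?_⟩
  have hH1 : 1 ≤ H := by
    have : (0:ℝ) ≤ n0.factorial := by positivity
    linarith
  have hex : ∃ n : ℕ, H ^ (2 * d + 1) ≤ n.factorial := by
    obtain ⟨m, hm⟩ := exists_nat_ge (H ^ (2 * d + 1))
    exact ⟨m, hm.trans (by exact_mod_cast Nat.self_le_factorial m)⟩
  classical
  set n := Nat.find hex with hn
  have hnf : H ^ (2 * d + 1) ≤ n.factorial := Nat.find_spec hex
  have hn0n : n0 < n := by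
    by_contra! hle
    have : (n.factorial : ℝ) ≤ n0.factorial := by exact_mod_cast Nat.factorial_le hle
    have h2 : H ≤ H ^ (2 * d + 1) := le_self_pow₀ hH1 (by omega)
    linarith
  have hnm : ((n-1).factorial : ℝ) < H ^ (2 * d + 1) := by
    have := Nat.find_min hex (m := n - 1) (by omega)
    exact not_le.1 this
  have h8 := hcn n (by omega)
  have hc1 : (1:ℝ) ≤ n.factorial := by exact_mod_cast Nat.one_le_iff_ne_zero.2 (Nat.factorial_ne_zero n)
  have pA : 8 * A ^ (4 * n) ≤ n.factorial := by
    refine le_trans ?_ h8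
    rw [pow_mul]
    gcongr
    linarith
  have pe : Real.exp n ≤ n.factorial := by
    have : Real.exp n ≤ c ^ n := by
      rw [show (n:ℝ) = n * 1 by ring, Real.exp_nat_mul]
      gcongr
      linarith
    have h0 : 0 < c ^ n := by positivity
    linarith
  have pk : ((2 * k + 1 : ℕ) : ℝ) ^ n ≤ n.factorial := by
    have : ((2 * k + 1 : ℕ) : ℝ) ^ n ≤ c ^ n := by
      gcongr
      push_cast
      linarith
    have h0 : 0 < c ^ n := by positivity
    linarith
  have pn : (n:ℝ) ^ n ≤ (n.factorial : ℝ) ^ 2 := by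
    have := Real.pow_div_factorial_le_exp (n:ℝ) (by positivity) n
    rw [div_le_iff₀ (by positivity)] at this
    nlinarith
  obtain ⟨p, hp, hnp, hp2⟩ := Nat.exists_prime_lt_and_le_two_mul n (by omega)
  have hApA : A ^ p ≤ A ^ (2 * n) := pow_le_pow_right₀ hA hp2
  refine ⟨p, hp, by omega, ?_, ?_⟩
  · have hpf : (n.factorial : ℝ) ≤ (p-1).factorial := by
      exact_mod_cast Nat.factorial_le (by omega)
    refine lt_of_lt_of_le ?_ hpf
    apply lt_of_pow_lt_pow_left₀ 2 (by positivity)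
    have e2 : H ^ (2 * d) ≤ n.factorial := (pow_le_pow_right₀ hH1 (by omega)).trans hnf
    calc (2 * (H ^ d * A ^ p)) ^ 2 ≤ (2 * (H ^ d * A ^ (2 * n))) ^ 2 := by gcongr
      _ = 4 * (H ^ (2 * d) * A ^ (4 * n)) := by ring
      _ < 8 * (H ^ (2 * d) * A ^ (4 * n)) := by
        have : 0 < H ^ (2 * d) * A ^ (4 * n) := by positivity
        linarith
      _ = H ^ (2 * d) * (8 * A ^ (4 * n)) := by ring
      _ ≤ n.factorial * n.factorial := by gcongr
      _ = _ := by ring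
  · have f1 : ((k * p + 1).factorial : ℝ) ≤ ((n.factorial : ℝ) ^ 3) ^ (2 * k + 1) := by
      have i1 : (k * p + 1).factorial ≤ ((2 * k + 1) * n) ^ ((2 * k + 1) * n) := by
        refine (Nat.factorial_le ?_).trans (Nat.factorial_le_pow _)
        nlinarith
      calc ((k * p + 1).factorial : ℝ) ≤ (((2 * k + 1 : ℕ) : ℝ) * n) ^ ((2 * k + 1) * n) := by
            exact_mod_cast i1
        _ = (((2 * k + 1 : ℕ) : ℝ) ^ n * (n:ℝ) ^ n) ^ (2 * k + 1) := by
            rw [← mul_pow, ← pow_mul, mul_comm n]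
        _ ≤ ((n.factorial : ℝ) * (n.factorial : ℝ) ^ 2) ^ (2 * k + 1) := by gcongr
        _ = _ := by ring
    have hAp : A ^ p ≤ n.factorial := by
      have : A ^ (2 * n) ≤ A ^ (4 * n) := pow_le_pow_right₀ hA (by omega)
      have : 0 < A ^ (4 * n) := by positivity
      linarith
    have hHd : H ^ d ≤ n.factorial := (pow_le_pow_right₀ hH1 (by omega)).trans hnf
    have h2 : (2:ℝ) ≤ n.factorial := by
      have : 1 ≤ A ^ (4 * n) := one_le_pow₀ hA
      linarith
    have hsq : (n.factorial : ℝ) ≤ ((n-1).factorial : ℝ) ^ 2 := by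
      have : n ≤ (n-1).factorial := by
        obtain ⟨m, hm⟩ : ∃ m, n = m + 3 := ⟨n - 3, by omega⟩
        rw [hm]
        simp only [Nat.add_succ_sub_one]
        rw [Nat.factorial_succ]
        have := Nat.self_le_factorial (m+1)
        nlinarith
      rw [← Nat.mul_factorial_pred (show n ≠ 0 by omega)]
      push_cast
      have : (n:ℝ) ≤ ((n-1).factorial : ℝ) := by exact_mod_cast this
      rw [pow_two]
      gcongr
    calc _ ≤ (n.factorial : ℝ) * (((n.factorial : ℝ) ^ 3) ^ (2 * k + 1) * n.factorial * n.factorial) := by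
          gcongr
      _ = (n.factorial : ℝ) ^ (6 * k + 6) := by ring
      _ ≤ (((n-1).factorial : ℝ) ^ 2) ^ (6 * k + 6) := by gcongr
      _ = ((n-1).factorial : ℝ) ^ (2 * (6 * k + 6)) := by rw [← pow_mul]
      _ ≤ (H ^ (2 * d + 1)) ^ (2 * (6 * k + 6)) := by gcongr
      _ = _ := by rw [← pow_mul]

section core
variable {O G : Type*} [CommRing O] [DecidableEq O] [IsDedekindDomain O] [CharZero O] [UniqueSums O]
  [Group G] [Fintype G] [DecidableEq G] [MulSemiringAction G O]

/-- Subset sums of the conjugates of `γ`. -/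
def LA.th (γ : O) (ε : G → Bool) : O := ∑ g : G, if ε g then g • γ else 0

/-- Coefficients of the expanded product. -/
def LA.co (a b : O) (ε : G → Bool) : O := ∏ g : G, if ε g then g • b else -(g • a)

/-- The set of exponents. -/
def LA.TT (G : Type*) {O : Type*} [CommRing O] [DecidableEq O] [Group G] [Fintype G] [DecidableEq G]
    [MulSemiringAction G O] (γ : O) : Finset O :=
  Finset.univ.image (fun ε : G → Bool => LA.th γ ε)

/-- The action on sign patterns. -/
def LA.ee (g : G) : (G → Bool) ≃ (G → Bool) := (Equiv.mulLeft g).arrowCongr (Equiv.refl _)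

lemma LA.smul_th (γ : O) (g : G) (ε : G → Bool) : g • LA.th γ ε = LA.th γ (LA.ee g ε) := by
  unfold LA.th
  rw [Finset.smul_sum, ← Equiv.sum_comp (Equiv.mulLeft g) (fun h => if (LA.ee g ε) h then h • γ else 0)]
  refine Finset.sum_congr rfl fun h _ => ?_
  simp [LA.ee, mul_smul, smul_ite]

lemma LA.smul_co (a b : O) (g : G) (ε : G → Bool) : g • LA.co a b ε = LA.co a b (LA.ee g ε) := by
  unfold LA.co
  rw [Finset.smul_prod', ← Equiv.prod_comp (Equiv.mulLeft g) (fun h => if (LA.ee g ε) h then h • b else -(h • a))]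
  refine Finset.prod_congr rfl fun h _ => ?_
  simp [LA.ee, mul_smul, smul_ite]

lemma LA.smul_TT (γ : O) (g : G) (t : O) (ht : t ∈ LA.TT G γ) : g • t ∈ LA.TT G γ := by
  unfold LA.TT at *
  rw [Finset.mem_image] at *
  obtain ⟨ε, -, rfl⟩ := ht
  exact ⟨LA.ee g ε, Finset.mem_univ _, (LA.smul_th γ g ε).symm⟩

lemma LA.map_F (γ : O) (p : ℕ) (g : G) (s : O) :
    (LA.F (LA.TT G γ) p s).map (MulSemiringAction.toRingHom G O g) =
      LA.F (LA.TT G γ) p (g • s) := by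
  unfold LA.F
  rw [Polynomial.map_mul, Polynomial.map_prod]
  simp only [Polynomial.map_pow, Polynomial.map_sub, map_X, map_C, MulSemiringAction.toRingHom_apply]
  congr 1
  refine Finset.prod_equiv (MulAction.toPerm g) ?_ ?_
  · intro t
    simp only [Finset.mem_erase, MulAction.toPerm_apply, ne_eq, smul_left_cancel_iff]
    refine and_congr_right fun _ => ⟨LA.smul_TT γ g t, fun h => ?_⟩
    simpa using LA.smul_TT γ g⁻¹ _ h
  · intro t _
    simp

/-- The value of the linear form. -/
noncomputable def LA.Lam (γ a b : O) (p : ℕ) (s : O) : O :=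
  ∑ ε : G → Bool, LA.co a b ε * eval (LA.th γ ε) (sumIDeriv (LA.F (LA.TT G γ) p s))

lemma LA.smul_Lam (γ a b : O) (p : ℕ) (s : O) (g : G) :
    g • LA.Lam (G := G) γ a b p s = LA.Lam (G := G) γ a b p (g • s) := by
  unfold LA.Lam
  rw [Finset.smul_sum, ← Equiv.sum_comp (LA.ee g) (fun ε => LA.co a b ε *
    eval (LA.th γ ε) (sumIDeriv (LA.F (LA.TT G γ) p (g • s))))]
  refine Finset.sum_congr rfl fun ε _ => ?_
  rw [smul_mul', LA.smul_co, ← LA.smul_th, ← LA.map_F γ p g s, sumIDeriv_map]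
  congr 1
  have := Polynomial.eval_map_apply (f := MulSemiringAction.toRingHom G O g)
    (p := sumIDeriv (LA.F (LA.TT G γ) p s)) (LA.th γ ε)
  simpa using this.symm

lemma LA.L_eq (ψ : O →+* ℂ) (γ a b : O) :
    ∏ g : G, (ψ (g • b) * Complex.exp (ψ (g • γ)) - ψ (g • a)) =
      ∑ ε : G → Bool, ψ (LA.co a b ε) * Complex.exp (ψ (LA.th γ ε)) := by
  have h2 : ∀ g : G, ψ (g • b) * Complex.exp (ψ (g • γ)) - ψ (g • a) =
      ∑ j : Bool, (ψ (if j then g • b else -(g • a)) * Complex.exp (ψ (if j then g • γ else 0))) := by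
    intro g; simp [sub_eq_add_neg]
  simp_rw [h2]
  rw [Finset.prod_univ_sum, Fintype.piFinset_univ]
  refine Finset.sum_congr rfl fun ε _ => ?_
  rw [Finset.prod_mul_distrib, LA.co, LA.th, map_prod, map_sum, Complex.exp_sum]

lemma LA.norm_F (ψ : O →+* ℂ) (T : Finset O) (R : ℝ) (hR : 1 ≤ R) (hT : ∀ t ∈ T, ‖ψ t‖ ≤ R) (p : ℕ)
    (hp : 0 < p) (s : O) (hs : s ∈ T) (z : ℂ) (hz : ‖z‖ ≤ R) :
    ‖((LA.F T p s).map ψ).eval z‖ ≤ (2 * R) ^ (T.card * p) := by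
  unfold LA.F
  have hf : ∀ t ∈ T, ‖z - ψ t‖ ≤ 2 * R := fun t ht =>
    (norm_sub_le _ _).trans (by linarith [hT t ht])
  simp only [Polynomial.map_mul, Polynomial.map_prod, Polynomial.map_pow, Polynomial.map_sub, map_X,
    map_C, eval_mul, eval_prod, eval_pow, eval_sub, eval_X, eval_C, norm_mul, norm_prod, norm_pow]
  rw [← Finset.card_erase_add_one hs]
  calc _ ≤ (2 * R) ^ (p - 1) * ∏ t ∈ T.erase s, (2 * R) ^ p := by
        gcongr with t ht
        · exact hf s hs
        · exact hf t (Finset.mem_of_mem_erase ht)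
    _ ≤ (2 * R) ^ p * ∏ t ∈ T.erase s, (2 * R) ^ p := by
        gcongr
        · linarith
        · omega
    _ = _ := by
        rw [Finset.prod_const, ← pow_mul, ← pow_add]
        ring_nf

lemma LA.deg_F (ψ : O →+* ℂ) (T : Finset O) (p : ℕ) (s : O) (hs : s ∈ T) :
    ((LA.F T p s).map ψ).natDegree ≤ T.card * p := by
  unfold LA.F
  simp only [Polynomial.map_mul, Polynomial.map_prod, Polynomial.map_pow, Polynomial.map_sub, map_X,
    map_C]
  have h1 := natDegree_prod_le (T.erase s) (fun t => (X - C (ψ t)) ^ p)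
  simp only [natDegree_pow, natDegree_X_sub_C, Finset.sum_const, smul_eq_mul, mul_one] at h1
  refine natDegree_mul_le.trans ?_
  rw [natDegree_pow, natDegree_X_sub_C, ← Finset.card_erase_add_one hs]
  have : p - 1 ≤ p := Nat.sub_le _ _
  nlinarith

theorem LA.core (ψ : O →+* ℂ) (hnorm : ∀ x : O, x ≠ 0 → ∃ g : G, 1 ≤ ‖ψ (g • x)‖)
    (hInteg : ∀ x : O, x ≠ 0 → ∃ N : ℤ, N ≠ 0 ∧ x ∣ (N : O)) (γ : O) (hγ : γ ≠ 0) :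
    ∃ C : ℕ, ∃ H0 : ℝ, ∀ H ≥ H0, ∀ a b : O, b ≠ 0 → (∀ g : G, ‖ψ (g • a)‖ ≤ H) →
      (∀ g : G, ‖ψ (g • b)‖ ≤ H) → 1 ≤ H ^ C * ‖ψ b * Complex.exp (ψ γ) - ψ a‖ := by
  set T := LA.TT G γ with hT
  set k := T.card with hk
  set d := Fintype.card G with hd
  set R : ℝ := 1 + ∑ t ∈ T, ‖ψ t‖ + ∑ g : G, ‖ψ (g • γ)‖ with hRdef
  have hs1 : 0 ≤ ∑ t ∈ T, ‖ψ t‖ := by positivity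
  have hs2 : 0 ≤ ∑ g : G, ‖ψ (g • γ)‖ := by positivity
  have hR1 : 1 ≤ R := by linarith
  have hRT : ∀ t ∈ T, ‖ψ t‖ ≤ R := fun t ht => by
    have := Finset.single_le_sum (f := fun t => ‖ψ t‖) (fun i _ => norm_nonneg _) ht
    linarith
  have hRg : ∀ g : G, ‖ψ (g • γ)‖ ≤ R := fun g => by
    have := Finset.single_le_sum (f := fun g : G => ‖ψ (g • γ)‖) (fun i _ => norm_nonneg _)
      (Finset.mem_univ g)
    linarith
  obtain ⟨N, hN0, hN⟩ := hInteg (∏ s ∈ T, ∏ t ∈ T.erase s, (s - t)) (by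
    rw [Finset.prod_ne_zero_iff]
    intro s _
    rw [Finset.prod_ne_zero_iff]
    intro t ht
    exact sub_ne_zero.2 (Finset.ne_of_mem_erase ht).symm)
  set A1 : ℝ := 2 ^ d * R * Real.exp (2 * R) with hA1
  set A2 : ℝ := (Real.exp R + 1) ^ d with hA2
  set A : ℝ := A1 * A2 * (2 * R) ^ k with hA
  have hA1' : 1 ≤ A1 := by
    have e1 : (1:ℝ) ≤ 2 ^ d := one_le_pow₀ (by norm_num)
    have e2 : (1:ℝ) ≤ Real.exp (2 * R) := Real.one_le_exp (by linarith)
    exact one_le_mul_of_one_le_of_one_le (one_le_mul_of_one_le_of_one_le e1 hR1) e2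
  have hA2' : 1 ≤ A2 := one_le_pow₀ (by linarith [Real.exp_pos R])
  have hA3' : 1 ≤ (2 * R) ^ k := one_le_pow₀ (by linarith)
  have hA' : 1 ≤ A := one_le_mul_of_one_le_of_one_le (one_le_mul_of_one_le_of_one_le hA1' hA2') hA3'
  obtain ⟨C, H0, hnum⟩ := LA.num k d N.natAbs A hA'
  refine ⟨C, max H0 1, fun H hH a b hb hHa hHb => ?_⟩
  have hH1 : 1 ≤ H := (le_max_right _ _).trans hH
  obtain ⟨p, hp, hpN, hn1, hn2⟩ := hnum H ((le_max_left _ _).trans hH)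
  by_contra! hlt
  set δ := ‖ψ b * Complex.exp (ψ γ) - ψ a‖ with hδ
  have hδ0 : 0 ≤ δ := norm_nonneg _
  have hfp : (0:ℝ) < (p-1).factorial := by positivity
  have hAp : A1 * (2 * R) ^ (k * p) ≤ A ^ p := by
    rw [hA, mul_pow (A1 * A2), ← pow_mul]
    gcongr
    exact (le_mul_of_one_le_right (by positivity) hA2').trans (le_self_pow₀ (one_le_mul_of_one_le_of_one_le hA1' hA2') hp.ne_zero)
  have hAp2 : A2 * (2 * R) ^ (k * p) ≤ A ^ p := by
    rw [hA, mul_pow (A1 * A2), ← pow_mul]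
    gcongr
    exact (le_mul_of_one_le_left (by positivity) hA1').trans (le_self_pow₀ (one_le_mul_of_one_le_of_one_le hA1' hA2') hp.ne_zero)
  -- the linear form
  set L := ∏ g : G, (ψ (g • b) * Complex.exp (ψ (g • γ)) - ψ (g • a)) with hL
  have hLn : ‖L‖ ≤ δ * (H ^ d * A2) := by
    have hfac : ∀ g : G, ‖ψ (g • b) * Complex.exp (ψ (g • γ)) - ψ (g • a)‖ ≤ H * (Real.exp R + 1) := by
      intro g
      refine (norm_sub_le _ _).trans ?_
      rw [norm_mul, mul_add, mul_one, Complex.norm_exp]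
      have : (ψ (g • γ)).re ≤ R := (Complex.re_le_norm _).trans (hRg g)
      have := hHa g
      have := hHb g
      gcongr
    have h1 : 1 ≤ H * (Real.exp R + 1) := by nlinarith [Real.exp_pos R]
    rw [hL, ← Finset.mul_prod_erase _ _ (Finset.mem_univ (1:G)), norm_mul]
    simp only [one_smul]
    rw [← hδ, norm_prod]
    gcongr
    calc _ ≤ ∏ g ∈ Finset.univ.erase (1:G), (H * (Real.exp R + 1)) := by
          gcongr with g hg
          exact hfac g
      _ ≤ (H * (Real.exp R + 1)) ^ d := by
          rw [Finset.prod_const]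
          exact pow_le_pow_right₀ h1 (by rw [hd]; exact Finset.card_le_univ _)
      _ = _ := by rw [mul_pow]
  have hco : ∀ ε : G → Bool, ‖ψ (LA.co a b ε)‖ ≤ H ^ d := by
    intro ε
    rw [LA.co, map_prod, norm_prod, hd, ← Finset.card_univ, ← Finset.prod_const]
    gcongr with g _
    split_ifs
    · exact hHb g
    · simpa using hHa g
  have hsmall : ∀ s ∈ T, ‖ψ (LA.Lam (G := G) γ a b p s)‖ < (p-1).factorial := by
    intro s hs
    set Q := (LA.F T p s).map ψ with hQ
    have hFb : ∀ z : ℂ, ‖z‖ ≤ R → ‖Q.eval z‖ ≤ (2 * R) ^ (k * p) := fun z hz =>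
      LA.norm_F ψ T R hR1 hRT p hp.pos s hs z hz
    have hQ0 := LA.an2 Q _ (k * p) (LA.deg_F ψ T p s hs) (fun z hz => hFb z (hz.trans hR1))
    have e1 : ψ (LA.Lam (G := G) γ a b p s) = Q.sumIDeriv.eval 0 * L -
        ∑ ε : G → Bool, ψ (LA.co a b ε) * (Complex.exp (ψ (LA.th γ ε)) * Q.sumIDeriv.eval 0 -
          Q.sumIDeriv.eval (ψ (LA.th γ ε))) := by
      rw [hL, LA.L_eq, LA.Lam, map_sum, Finset.mul_sum, ← Finset.sum_sub_distrib]
      refine Finset.sum_congr rfl fun ε _ => ?_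
      have : ψ (eval (LA.th γ ε) (sumIDeriv (LA.F T p s))) = Q.sumIDeriv.eval (ψ (LA.th γ ε)) := by
        rw [hQ, sumIDeriv_map, Polynomial.eval_map_apply]
      rw [map_mul, this]
      ring
    have e2 : ‖∑ ε : G → Bool, ψ (LA.co a b ε) * (Complex.exp (ψ (LA.th γ ε)) * Q.sumIDeriv.eval 0 -
          Q.sumIDeriv.eval (ψ (LA.th γ ε)))‖ ≤ H ^ d * A ^ p := by
      refine (norm_sum_le _ _).trans ?_
      have : ∀ ε ∈ (Finset.univ : Finset (G → Bool)), ‖ψ (LA.co a b ε) * (Complex.exp (ψ (LA.th γ ε)) * Q.sumIDeriv.eval 0 -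
          Q.sumIDeriv.eval (ψ (LA.th γ ε)))‖ ≤ H ^ d * (R * Real.exp (2 * R) * (2 * R) ^ (k * p)) := by
        intro ε _
        rw [norm_mul]
        gcongr
        · exact hco ε
        · exact LA.an1 Q _ R hFb _ (hRT _ (Finset.mem_image_of_mem _ (Finset.mem_univ ε)))
      refine (Finset.sum_le_card_nsmul _ _ _ this).trans ?_
      rw [Finset.card_univ, Fintype.card_fun, Fintype.card_bool, ← hd, nsmul_eq_mul]
      push_cast
      calc _ = H ^ d * (A1 * (2 * R) ^ (k * p)) := by rw [hA1]; ring
        _ ≤ _ := by gcongr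
    have e3 : ‖Q.sumIDeriv.eval 0 * L‖ ≤ (((k * p + 1).factorial : ℝ) * A ^ p * H ^ d) * δ := by
      rw [norm_mul]
      calc _ ≤ (((k * p + 1).factorial : ℝ) * (2 * R) ^ (k * p)) * (δ * (H ^ d * A2)) := by gcongr
        _ = (((k * p + 1).factorial : ℝ) * (A2 * (2 * R) ^ (k * p)) * H ^ d) * δ := by ring
        _ ≤ _ := by gcongr
    have e4 : 2 * ((((k * p + 1).factorial : ℝ) * A ^ p * H ^ d) * δ) < 1 := by
      calc _ = (2 * (((k * p + 1).factorial : ℝ) * A ^ p * H ^ d)) * δ := by ring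
        _ ≤ H ^ C * δ := by gcongr
        _ < 1 := hlt
    have e5 : (1:ℝ) ≤ (p-1).factorial := by
      exact_mod_cast Nat.one_le_iff_ne_zero.2 (Nat.factorial_ne_zero _)
    rw [e1]
    refine (norm_sub_le _ _).trans_lt ?_
    linarith
  -- nonvanishing
  have hpu : ¬ IsUnit (p : O) := by
    intro hu
    obtain ⟨u, hu⟩ := hu.exists_right_inv
    have hu0 : u ≠ 0 := by rintro rfl; simp at hu
    obtain ⟨g, hg⟩ := hnorm u hu0
    have h1 : ψ (g • ((p:O) * u)) = 1 := by rw [hu]; simp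
    rw [smul_mul', map_mul] at h1
    have h2 : g • (p : O) = p := map_natCast (MulSemiringAction.toRingHom G O g) p
    rw [h2, map_natCast] at h1
    have h3 := congrArg norm h1
    rw [norm_mul, norm_one, Complex.norm_natCast] at h3
    have : (2:ℝ) ≤ p := by exact_mod_cast hp.two_le
    nlinarith
  have hpN' : ¬ (p : ℤ) ∣ N := by
    intro h
    have := Int.natAbs_dvd_natAbs.2 h
    simp only [Int.natAbs_natCast] at this
    exact absurd (Nat.le_of_dvd (Int.natAbs_pos.2 hN0) this) (by omega)
  obtain ⟨t, ht⟩ := LA.expand (fun g : G => g • b) (fun g : G => -(g • a)) (fun g : G => g • γ)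
    (fun g => (smul_ne_zero_iff_ne g).2 hb) (fun g => (smul_ne_zero_iff_ne g).2 hγ)
  have htT : t ∈ T := by
    by_contra hn
    apply ht
    rw [Finset.filter_false_of_mem, Finset.sum_empty]
    intro ε _ h
    exact hn (Finset.mem_image.2 ⟨ε, Finset.mem_univ _, h⟩)
  obtain ⟨s, hs, hne⟩ := LA.nonvan T p hp hpu N hpN'
    (fun s hs => (Finset.dvd_prod_of_mem (fun s => ∏ t ∈ T.erase s, (s - t)) hs).trans hN)
    (fun t => ∑ ε : G → Bool with LA.th γ ε = t, LA.co a b ε) ⟨t, htT, ht⟩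
  have hLam : ∑ t ∈ T, (∑ ε : G → Bool with LA.th γ ε = t, LA.co a b ε) * eval t (sumIDeriv (LA.F T p s))
      = LA.Lam (G := G) γ a b p s := by
    unfold LA.Lam
    rw [← Finset.sum_fiberwise_of_maps_to (t := T) (g := fun ε : G → Bool => LA.th γ ε)
      (fun ε hε => Finset.mem_image_of_mem _ hε)]
    refine Finset.sum_congr rfl fun t _ => ?_
    rw [Finset.sum_mul]
    refine Finset.sum_congr rfl fun ε hε => ?_
    rw [(Finset.mem_filter.1 hε).2]
  simp only [hLam] at hne
  have hdv : ((p-1).factorial : O) ∣ LA.Lam (G := G) γ a b p s := by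
    unfold LA.Lam
    refine Finset.dvd_sum fun ε _ => Dvd.dvd.mul_left ?_ _
    exact LA.M_dvd T p hp.pos s _ (Finset.mem_image_of_mem _ (Finset.mem_univ ε))
  obtain ⟨μ, hμ⟩ := hdv
  have hμ0 : μ ≠ 0 := by rintro rfl; simp at hμ; exact hne hμ
  obtain ⟨g, hg⟩ := hnorm μ hμ0
  have h1 := hsmall (g • s) (LA.smul_TT γ g s hs)
  rw [← LA.smul_Lam, hμ, smul_mul', map_mul] at h1
  have h2 : g • ((p-1).factorial : O) = ((p-1).factorial : O) :=
    map_natCast (MulSemiringAction.toRingHom G O g) _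
  rw [h2, map_natCast, norm_mul, Complex.norm_natCast] at h1
  nlinarith
end core

lemma LA.exists_field (γ : ℂ) (hγ : IsAlgebraic ℚ γ) : ∃ K : IntermediateField ℚ ℂ,
    FiniteDimensional ℚ K ∧ IsGalois ℚ K ∧ γ ∈ K ∧ Complex.I ∈ K := by
  have hInteg := hγ.isIntegral
  set f : ℚ[X] := minpoly ℚ γ * (X ^ 2 + 1) with hf
  have h2 : (X ^ 2 + 1 : ℚ[X]) ≠ 0 := (by monicity! : (X ^ 2 + 1 : ℚ[X]).Monic).ne_zero
  have hf0 : f ≠ 0 := mul_ne_zero (minpoly.ne_zero hInteg) h2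
  set K := IntermediateField.adjoin ℚ (f.rootSet ℂ) with hK
  have hs : f.IsSplittingField ℚ K :=
    IntermediateField.adjoin_rootSet_isSplittingField (IsAlgClosed.splits _)
  have hfd : FiniteDimensional ℚ K := Polynomial.IsSplittingField.finiteDimensional K f
  have hn : Normal ℚ K := Normal.of_isSplittingField f
  refine ⟨K, hfd, ⟨⟩, ?_, ?_⟩
  · apply IntermediateField.subset_adjoin
    rw [mem_rootSet]
    exact ⟨hf0, by simp [hf]⟩
  · apply IntermediateField.subset_adjoin
    rw [mem_rootSet]
    exact ⟨hf0, by simp [hf]⟩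

open NumberField in
lemma LA.coreK (K : IntermediateField ℚ ℂ) [FiniteDimensional ℚ K] [IsGalois ℚ K]
    (γ : 𝓞 K) (hγ : γ ≠ 0) :
    ∃ C : ℕ, ∃ H0 : ℝ, ∀ H ≥ H0, ∀ a b : 𝓞 K, b ≠ 0 →
      (∀ g : K ≃ₐ[ℚ] K, ‖(((g • a : 𝓞 K) : K) : ℂ)‖ ≤ H) →
      (∀ g : K ≃ₐ[ℚ] K, ‖(((g • b : 𝓞 K) : K) : ℂ)‖ ≤ H) →
      1 ≤ H ^ C * ‖((b : K) : ℂ) * Complex.exp ((γ : K) : ℂ) - ((a : K) : ℂ)‖ := by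
  classical
  have : NumberField K := { }
  have : UniqueSums (𝓞 K) := UniqueSums.of_injective_addHom
    ((algebraMap (𝓞 K) K : 𝓞 K →+ K) : AddHom (𝓞 K) K) RingOfIntegers.coe_injective inferInstance
  set ψ : 𝓞 K →+* ℂ := (algebraMap K ℂ).comp (algebraMap (𝓞 K) K) with hψ
  have hnz : ∀ x : 𝓞 K, x ≠ 0 → Algebra.norm ℤ x ≠ 0 := fun x hx => Algebra.norm_ne_zero_iff.2 hx
  have hprod : ∀ x : 𝓞 K, ∏ g : K ≃ₐ[ℚ] K, g • x = ((Algebra.norm ℤ x : ℤ) : 𝓞 K) := by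
    intro x
    apply RingOfIntegers.coe_injective
    have h1 := Algebra.norm_eq_prod_automorphisms ℚ (x : K)
    rw [← Algebra.coe_norm_int] at h1
    rw [map_prod]
    simp only [map_intCast] at h1 ⊢
    rw [h1]
    rfl
  refine LA.core (G := K ≃ₐ[ℚ] K) ψ ?_ ?_ γ hγ
  · intro x hx
    by_contra! H
    have h1 := congrArg (fun y => ‖ψ y‖) (hprod x)
    simp only [map_prod, norm_prod, map_intCast] at h1
    have h2 : ∏ g : K ≃ₐ[ℚ] K, ‖ψ (g • x)‖ < 1 := by
      rw [← Finset.mul_prod_erase _ _ (Finset.mem_univ (1 : K ≃ₐ[ℚ] K))]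
      exact mul_lt_one_of_nonneg_of_lt_one_left (norm_nonneg _) (H _)
        (Finset.prod_le_one (fun _ _ => norm_nonneg _) (fun g _ => (H g).le))
    rw [h1, Complex.norm_intCast] at h2
    exact hnz x hx (Int.abs_lt_one_iff.1 (by exact_mod_cast h2))
  · intro x hx
    refine ⟨Algebra.norm ℤ x, hnz x hx, ?_⟩
    rw [← hprod]
    have := Finset.dvd_prod_of_mem (fun g : K ≃ₐ[ℚ] K => g • x) (Finset.mem_univ (1 : K ≃ₐ[ℚ] K))
    simpa using this

lemma LA.pow_sub (x y : ℂ) (M : ℝ) (hM : 1 ≤ M) (hx : ‖x‖ ≤ M) (hy : ‖y‖ ≤ M) (D : ℕ) :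
    ‖x ^ D - y ^ D‖ ≤ D * M ^ D * ‖x - y‖ := by
  rw [← geom_sum₂_mul, norm_mul]
  gcongr
  refine (norm_sum_le _ _).trans ?_
  have : ∀ i ∈ Finset.range D, ‖x ^ i * y ^ (D - 1 - i)‖ ≤ M ^ D := by
    intro i hi
    rw [Finset.mem_range] at hi
    rw [norm_mul, norm_pow, norm_pow]
    calc _ ≤ M ^ i * M ^ (D - 1 - i) := by gcongr
      _ = M ^ (i + (D - 1 - i)) := by rw [pow_add]
      _ ≤ M ^ D := pow_le_pow_right₀ hM (by omega)
  refine (Finset.sum_le_card_nsmul _ _ _ this).trans ?_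
  simp

lemma LA.tan_form (α : ℝ) (q p : ℝ) (hq : 0 < q) :
    ‖((q : ℂ) - p * Complex.I) * Complex.exp (2 * Complex.I * (Real.arctan α : ℝ)) -
      (q + p * Complex.I)‖ ≤ 2 * q * |α - p / q| := by
  set β := Real.arctan α with hβ
  have hc : 0 < Real.cos β := Real.cos_arctan_pos α
  have hs : Real.sin β = α * Real.cos β := by
    have := Real.tan_arctan α
    rw [Real.tan_eq_sin_div_cos, div_eq_iff (Real.cos_arctan_pos α).ne'] at this
    exact this
  have e1 : Complex.exp (2 * Complex.I * (β : ℝ)) = Complex.exp (β * Complex.I) ^ 2 := by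
    rw [← Complex.exp_nat_mul]; congr 1; push_cast; ring
  have hE : Complex.exp (β * Complex.I) = (Real.cos β : ℝ) + (Real.sin β : ℝ) * Complex.I := by
    rw [Complex.exp_mul_I, Complex.ofReal_cos, Complex.ofReal_sin]
  have hsc : ((Real.sin β : ℝ) : ℂ) ^ 2 + ((Real.cos β : ℝ) : ℂ) ^ 2 = 1 := by
    exact_mod_cast Real.sin_sq_add_cos_sq β
  have e2 : ((q : ℂ) - p * Complex.I) * Complex.exp (2 * Complex.I * (β : ℝ)) -
      (q + p * Complex.I) = Complex.exp (β * Complex.I) *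
        (2 * Complex.I * ((q * Real.sin β - p * Real.cos β : ℝ) : ℂ)) := by
    rw [e1, hE]
    push_cast only [Complex.ofReal_sub, Complex.ofReal_mul]
    generalize ((Real.sin β : ℝ) : ℂ) = S at *
    generalize ((Real.cos β : ℝ) : ℂ) = T at *
    linear_combination (q + p * Complex.I) * hsc + (- q * S ^ 2 - p * S ^ 2 * Complex.I) * Complex.I_sq
  rw [e2, norm_mul, Complex.norm_exp_ofReal_mul_I, one_mul, norm_mul, norm_mul, Complex.norm_I,
    Complex.norm_real, hs]
  have e3 : q * (α * Real.cos β) - p * Real.cos β = q * (α - p / q) * Real.cos β := by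
    field_simp
  rw [e3, Real.norm_eq_abs, abs_mul, abs_mul, abs_of_pos hq, abs_of_pos hc]
  have : Real.cos β ≤ 1 := Real.cos_le_one β
  have h0 : 0 ≤ q * |α - p / q| := by positivity
  simp
  nlinarith

open NumberField in
theorem liouville_arctan_transcendental (α : ℝ) (h : Liouville α) :
    Transcendental ℚ (Real.arctan α) := by
  intro halg
  have hα0 : α ≠ 0 := by
    rintro rfl
    exact h.irrational ⟨0, by simp⟩
  set β := Real.arctan α with hβ
  have hβ0 : β ≠ 0 := by
    rw [hβ, Ne, Real.arctan_eq_zero_iff]; exact hα0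
  set γ0 : ℂ := 2 * Complex.I * (β : ℝ) with hγ0
  have hγ00 : γ0 ≠ 0 := by simp [hγ0, hβ0]
  have hIint : IsIntegral ℤ Complex.I := ⟨X ^ 2 + 1, by monicity!, by simp⟩
  have hγalg : IsAlgebraic ℚ γ0 := by
    have h1 : IsAlgebraic ℚ ((β : ℝ) : ℂ) := halg.algebraMap
    have h2 : IsAlgebraic ℚ Complex.I := (hIint.tower_top (A := ℚ)).isAlgebraic
    have h3 : IsAlgebraic ℚ (2 : ℂ) := by
      simpa using isAlgebraic_algebraMap (A := ℂ) (2 : ℚ)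
    exact (h3.mul h2).mul h1
  obtain ⟨K, hfd, hgal, hγK, hIK⟩ := LA.exists_field γ0 hγalg
  obtain ⟨D, hD0, hDint⟩ : ∃ D : ℕ, D ≠ 0 ∧ IsIntegral ℤ ((D : ℂ) * γ0) := by
    have : IsAlgebraic ℤ γ0 := (IsFractionRing.isAlgebraic_iff ℤ ℚ ℂ).2 hγalg
    obtain ⟨y, hy0, hy⟩ := this.exists_integral_multiple
    refine ⟨y.natAbs, Int.natAbs_ne_zero.2 hy0, ?_⟩
    rcases Int.natAbs_eq y with h | h
    · rw [h] at hy
      simpa using hy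
    · rw [h] at hy
      simpa using hy.neg
  have hcoe : ∀ x : K, IsIntegral ℤ (x : ℂ) → IsIntegral ℤ x := fun x hx =>
    (isIntegral_algHom_iff (K.val.restrictScalars ℤ) Subtype.val_injective).1 hx
  have hDK : (D : ℂ) * γ0 ∈ K := mul_mem (natCast_mem K D) hγK
  set γ : 𝓞 K := ⟨⟨_, hDK⟩, hcoe _ hDint⟩ with hγ
  have hγc : ((γ : K) : ℂ) = D * γ0 := rfl
  set i : 𝓞 K := ⟨⟨_, hIK⟩, hcoe _ hIint⟩ with hi
  have hic : ((i : K) : ℂ) = Complex.I := rfl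
  have hii : i ^ 2 = -1 := by
    apply RingOfIntegers.coe_injective
    apply Subtype.val_injective
    show (((i ^ 2 : 𝓞 K) : K) : ℂ) = (((-1 : 𝓞 K) : K) : ℂ)
    push_cast
    rw [hic]
    simp
  have hγne : γ ≠ 0 := by
    intro h0
    have : ((γ : K) : ℂ) = 0 := by rw [h0]; rfl
    rw [hγc] at this
    exact mul_ne_zero (Nat.cast_ne_zero.2 hD0) hγ00 this
  have hgi : ∀ g : K ≃ₐ[ℚ] K, ‖(((g • i : 𝓞 K) : K) : ℂ)‖ = 1 := by
    intro g
    have h1 : (g • i) ^ 2 = -1 := by rw [← smul_pow', hii, smul_neg, smul_one]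
    have h2 : (((g • i : 𝓞 K) : K) : ℂ) ^ 2 = -1 := by
      have := congrArg (fun x : 𝓞 K => ((x : K) : ℂ)) h1
      simpa using this
    have h3 := congrArg norm h2
    rw [norm_pow, norm_neg, norm_one] at h3
    exact (pow_eq_one_iff_of_nonneg (norm_nonneg _) two_ne_zero).1 h3
  obtain ⟨C, H0, hcore⟩ := LA.coreK K γ hγne
  set B : ℝ := |α| + 2 with hB
  have hB1 : 1 ≤ B := by have := abs_nonneg α; linarith
  set K0 : ℝ := 2 * D * B ^ (D * C + D) with hK0
  have hfreq := h.frequently_exists_num (D * C + D + 2)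
  have hev : ∀ᶠ b : ℕ in Filter.atTop, 1 ≤ b ∧ H0 ≤ (b:ℝ) ∧ K0 < (b : ℝ) :=
    (Filter.eventually_ge_atTop 1).and
      ((tendsto_natCast_atTop_atTop.eventually_ge_atTop H0).and
        (tendsto_natCast_atTop_atTop.eventually_gt_atTop K0))
  obtain ⟨q, ⟨p, -, hlt⟩, hq1, hqH, hqK⟩ := (hfreq.and_eventually hev).exists
  have hq1' : (1:ℝ) ≤ q := by exact_mod_cast hq1
  have hq0 : (0:ℝ) < q := by linarith
  have hple : |(p:ℝ)| ≤ (|α| + 1) * q := by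
    have h1 : |α - p / q| < 1 := hlt.trans_le (by
      rw [div_le_one (by positivity)]; exact one_le_pow₀ hq1')
    have h2 : |(p:ℝ) / q| ≤ |α| + 1 := by
      have := abs_sub_abs_le_abs_sub ((p:ℝ) / q) α
      rw [abs_sub_comm] at this
      linarith
    rwa [abs_div, abs_of_pos hq0, div_le_iff₀ hq0] at h2
  set M : ℝ := B * q with hM
  have hM1 : 1 ≤ M := one_le_mul_of_one_le_of_one_le hB1 hq1'
  have hqM : (q:ℝ) ≤ M := by rw [hM]; nlinarith
  have hpq : (q:ℝ) + |(p:ℝ)| ≤ M := by rw [hM, hB]; linarith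
  have hHH : H0 ≤ M ^ D := (hqH.trans hqM).trans (le_self_pow₀ hM1 hD0)
  have hbd : ∀ z : ℂ, ‖z‖ = 1 → ‖(q:ℂ) + p * z‖ ≤ M := by
    intro z hz
    refine (norm_add_le _ _).trans ?_
    rw [norm_mul, hz, Complex.norm_natCast, Complex.norm_intCast, mul_one]
    exact hpq
  have hbd' : ∀ z : ℂ, ‖z‖ = 1 → ‖(q:ℂ) - p * z‖ ≤ M := by
    intro z hz
    have := hbd (-z) (by rwa [norm_neg])
    rwa [mul_neg, ← sub_eq_add_neg] at this
  have hsm : ∀ (g : K ≃ₐ[ℚ] K) (m : ℤ), g • (((q : 𝓞 K) + m * i) ^ D) = ((q : 𝓞 K) + m * (g • i)) ^ D := by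
    intro g m
    have e1 : g • (q : 𝓞 K) = q := map_natCast (MulSemiringAction.toRingHom (K ≃ₐ[ℚ] K) (𝓞 K) g) q
    have e2 : g • (m : 𝓞 K) = m := map_intCast (MulSemiringAction.toRingHom (K ≃ₐ[ℚ] K) (𝓞 K) g) m
    rw [smul_pow', smul_add, smul_mul', e1, e2]
  have hcast : ∀ (m : ℤ) (j : 𝓞 K), (((((q : 𝓞 K) + m * j) ^ D : 𝓞 K) : K) : ℂ) =
      ((q : ℂ) + m * ((j : K) : ℂ)) ^ D := by
    intro m j
    simp
  have hmain := hcore (M ^ D) hHH (((q : 𝓞 K) + (p : ℤ) * i) ^ D) (((q : 𝓞 K) + (-p : ℤ) * i) ^ D)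
    (by
      intro h0
      have := congrArg (fun x : 𝓞 K => ((x : K) : ℂ)) h0
      simp only [hcast] at this
      rw [hic] at this
      have h1 : ((q : ℂ) + (-p : ℤ) * Complex.I) ^ D = 0 := by simpa using this
      have h2 := congrArg Complex.re (pow_eq_zero_iff hD0 |>.1 h1)
      simp at h2
      omega)
    (fun g => by
      rw [hsm, hcast, norm_pow]
      exact pow_le_pow_left₀ (norm_nonneg _) (hbd _ (hgi g)) D)
    (fun g => by
      rw [hsm, hcast, norm_pow]
      refine pow_le_pow_left₀ (norm_nonneg _) ?_ D
      have := hbd' _ (hgi g)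
      push_cast
      rwa [neg_mul, ← sub_eq_add_neg])
  rw [hcast, hcast, hγc, hic, Complex.exp_nat_mul, ← mul_pow] at hmain
  have hexp : ‖Complex.exp γ0‖ = 1 := by
    rw [hγ0, show 2 * Complex.I * (β : ℂ) = ((2 * β : ℝ) : ℂ) * Complex.I by push_cast; ring,
      Complex.norm_exp_ofReal_mul_I]
  have hps := LA.pow_sub (((q : ℂ) + (-p : ℤ) * Complex.I) * Complex.exp γ0) ((q : ℂ) + (p : ℤ) * Complex.I)
    M hM1 (by
      rw [norm_mul, hexp, mul_one]
      push_cast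
      rw [neg_mul, ← sub_eq_add_neg]
      exact hbd' _ Complex.norm_I) (hbd _ Complex.norm_I) D
  have htf := LA.tan_form α q p hq0
  have e1 : ((q : ℂ) + (-p : ℤ) * Complex.I) * Complex.exp γ0 - ((q : ℂ) + (p : ℤ) * Complex.I) =
     (((q : ℝ) : ℂ) - ((p : ℝ) : ℂ) * Complex.I) * Complex.exp (2 * Complex.I * (Real.arctan α : ℝ)) -
      (((q : ℝ) : ℂ) + ((p : ℝ) : ℂ) * Complex.I) := by
    rw [hγ0, hβ]
    push_cast
    ring
  rw [e1] at hps
  have hfin : (1:ℝ) ≤ (M ^ D) ^ C * (D * M ^ D * (2 * q * (1 / (q:ℝ) ^ (D * C + D + 2)))) := by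
    refine hmain.trans ?_
    gcongr
    refine hps.trans ?_
    gcongr
    refine htf.trans ?_
    gcongr
  have e2 : (M ^ D) ^ C * (D * M ^ D * (2 * q * (1 / (q:ℝ) ^ (D * C + D + 2)))) = K0 / q := by
    rw [hM, hK0]
    have : (q:ℝ) ^ (D * C + D + 2) = q ^ (D * C + D) * q * q := by ring
    rw [this, mul_pow, mul_pow, ← pow_mul, ← pow_mul, pow_add B, pow_add (q:ℝ)]
    field_simp
  rw [e2, le_div_iff₀ hq0] at hfin
  linarith
end

section
/- If α is a Liouville number, then arcsinh α = log(α + √(α² + 1)) is transcendental. -/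
namespace LAT

noncomputable section

open scoped Nat
open Complex Polynomial LindemannWeierstrass

theorem coeff_pow_bound (f : ℤ[X]) : ∃ C : ℝ, 0 ≤ C ∧ ∀ p j : ℕ, |((f ^ p).coeff j : ℝ)| ≤ C ^ p := by
  refine ⟨∑ i ∈ f.support, |(f.coeff i : ℝ)|, Finset.sum_nonneg fun _ _ => abs_nonneg _, ?_⟩
  intro p
  induction p with
  | zero => intro j; simp only [pow_zero, coeff_one]; split_ifs <;> simp
  | succ p ih =>
    intro j
    set C := ∑ i ∈ f.support, |(f.coeff i : ℝ)|
    rw [pow_succ', coeff_mul, Finset.Nat.sum_antidiagonal_eq_sum_range_succ_mk, Int.cast_sum]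
    refine (Finset.abs_sum_le_sum_abs _ _).trans ?_
    have hC0 : 0 ≤ C := Finset.sum_nonneg fun _ _ => abs_nonneg _
    calc _ ≤ ∑ i ∈ Finset.range j.succ, |(f.coeff i : ℝ)| * C ^ p := by
          refine Finset.sum_le_sum fun i _ => ?_
          rw [Int.cast_mul, abs_mul]
          exact mul_le_mul_of_nonneg_left (ih _) (abs_nonneg _)
      _ = (∑ i ∈ Finset.range j.succ, |(f.coeff i : ℝ)|) * C ^ p := by rw [Finset.sum_mul]
      _ ≤ C * C ^ p := by
          refine mul_le_mul_of_nonneg_right ?_ (pow_nonneg hC0 _)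
          rw [← Finset.sum_filter_add_sum_filter_not (Finset.range j.succ) (· ∈ f.support)]
          have : ∑ x ∈ Finset.range j.succ with ¬ x ∈ f.support, |(f.coeff x : ℝ)| = 0 := by
            refine Finset.sum_eq_zero fun x hx => ?_
            simp at hx
            simp [hx.2]
          rw [this, add_zero]
          refine Finset.sum_le_sum_of_subset_of_nonneg ?_ (fun _ _ _ => abs_nonneg _)
          intro x hx
          exact (Finset.mem_filter.mp hx).2
      _ = _ := by rw [pow_succ']

theorem eval_sumIDeriv_bound (f : ℤ[X]) (C : ℝ) (C0 : 0 ≤ C)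
    (hC : ∀ p j : ℕ, |((f ^ p).coeff j : ℝ)| ≤ C ^ p) (p : ℕ) (hp : 0 < p) :
    |((eval 0 (sumIDeriv (X ^ (p - 1) * f ^ p)) : ℤ) : ℝ)| ≤ C ^ p * (p * (f.natDegree + 1))! := by
  set F := X ^ (p - 1) * f ^ p with hF
  have hdeg : F.natDegree ≤ p * (f.natDegree + 1) - 1 := by
    refine natDegree_mul_le.trans ?_
    rw [natDegree_X_pow, natDegree_pow]
    have : p * (f.natDegree + 1) = p * f.natDegree + p := by ring
    omega
  have hco : ∀ j, |(F.coeff j : ℝ)| ≤ C ^ p := by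
    intro j
    rw [hF, coeff_X_pow_mul']
    split_ifs
    · exact hC _ _
    · simpa using pow_nonneg C0 p
  have hpos : 0 < p * (f.natDegree + 1) := by positivity
  obtain ⟨m, hm⟩ : ∃ m, p * (f.natDegree + 1) = m + 1 := ⟨_, (Nat.succ_pred_eq_of_pos hpos).symm⟩
  rw [hm] at hdeg ⊢
  rw [sumIDeriv_apply_of_le hdeg, eval_finsetSum, Int.cast_sum]
  refine (Finset.abs_sum_le_sum_abs _ _).trans ?_
  calc _ ≤ ∑ i ∈ Finset.range (m + 1), C ^ p * m ! := by
        refine Finset.sum_le_sum fun i hi => ?_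
        rw [← coeff_zero_eq_eval_zero, coeff_iterate_derivative]
        simp only [zero_add, Nat.descFactorial_self, nsmul_eq_mul]
        push_cast
        rw [abs_mul, mul_comm, Nat.abs_cast]
        refine mul_le_mul (hco i) ?_ (by positivity) (pow_nonneg C0 _)
        exact_mod_cast Nat.factorial_le (by simpa [Nat.lt_succ_iff] using hi)
    _ = _ := by
        rw [Finset.sum_const, Finset.card_range, Nat.factorial_succ]
        push_cast; simp; ring

/-- The function I of the standard proof of Lindemann-Weierstrass. -/
def P (f : ℂ[X]) (s : ℂ) :=
  exp s * f.sumIDeriv.eval 0 - f.sumIDeriv.eval s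

theorem P_eq_integral_exp_mul_eval (f : ℂ[X]) (s : ℂ) :
    P f s = exp s * (s * ∫ x in 0..1, exp (-(x • s)) * f.eval (x • s)) := by
  rw [integral_exp_mul_eval, mul_add, mul_neg, exp_neg, mul_inv_cancel_left₀ (exp_ne_zero s),
    neg_add_eq_sub, P]

/--
Given a sequence of complex polynomials `fₚ`, a complex constant `s`, and a real constant `c` such
that `|fₚ(xs)| ≤ c ^ p` for all `p ∈ ℕ` and `x ∈ Ioc 0 1`, then there is also a nonnegative
constant `c'` such that for all nonzero `p ∈ ℕ`, `|P(fₚ, s)| ≤ c' ^ p`.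
-/
theorem P_le_aux (f : ℕ → ℂ[X]) (s : ℂ) (c : ℝ)
    (hc : ∀ p : ℕ, ∀ x ∈ Set.Ioc (0 : ℝ) 1, ‖(f p).eval (x • s)‖ ≤ c ^ p) :
    ∃ c' ≥ 0, ∀ p : ℕ,
      ‖P (f p) s‖ ≤
        Real.exp s.re * (Real.exp ‖s‖ * c' ^ p * ‖s‖) := by
  refine ⟨|c|, abs_nonneg _, fun p => ?_⟩
  rw [P_eq_integral_exp_mul_eval (f p) s, mul_comm s, norm_mul, norm_mul, norm_exp]
  gcongr
  rw [intervalIntegral.integral_of_le zero_le_one, ← mul_one (_ * _)]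
  convert! MeasureTheory.norm_setIntegral_le_of_norm_le_const _ _
  · rw [Real.volume_real_Ioc_of_le zero_le_one, sub_zero]
  · rw [Real.volume_Ioc, sub_zero]; exact ENNReal.ofReal_lt_top
  intro x hx
  rw [norm_mul, norm_exp]
  gcongr
  · simp only [Set.mem_Ioc] at hx
    apply (re_le_norm _).trans
    rw [norm_neg, norm_smul, Real.norm_of_nonneg hx.1.le]
    exact mul_le_of_le_one_left (norm_nonneg _) hx.2
  · rw [← abs_pow]
    exact (hc p x hx).trans (le_abs_self _)

/--
Given a sequence of complex polynomials `fₚ`, a complex constant `s`, and a real constant `c` such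
that `|fₚ(xs)| ≤ c ^ p` for all `p ∈ ℕ` and `x ∈ Ioc 0 1`, then there is also a nonnegative
constant `c'` such that for all nonzero `p ∈ ℕ`, `|P(fₚ, s)| ≤ c' ^ p`.
-/
theorem P_le (f : ℕ → ℂ[X]) (s : ℂ) (c : ℝ)
    (hc : ∀ p : ℕ, ∀ x ∈ Set.Ioc (0 : ℝ) 1, ‖(f p).eval (x • s)‖ ≤ c ^ p) :
    ∃ c' ≥ 0, ∀ p ≠ 0, ‖P (f p) s‖ ≤ c' ^ p := by
  obtain ⟨c', hc', h'⟩ := P_le_aux f s c hc; clear c hc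
  let c₁ := max (Real.exp s.re) 1
  let c₂ := max (Real.exp ‖s‖) 1
  let c₃ := max ‖s‖ 1
  use c₁ * (c₂ * c' * c₃), by positivity
  intro p hp
  refine (h' p).trans ?_
  simp_rw [mul_pow]
  have le_max_one_pow {x : ℝ} : x ≤ max x 1 ^ p :=
    (max_cases x 1).elim (fun h ↦ h.1.symm ▸ le_self_pow₀ h.2 hp)
      fun h ↦ by rw [h.1, one_pow]; exact h.2.le
  gcongr <;> exact le_max_one_pow

/--
Given a polynomial with integer coefficients `p` and a complex constant `s`, there is a nonnegative
`c` such that for all nonzero `q ∈ ℕ`, `|P(X ^ (q - 1) * p ^ q, s)| ≤ c ^ q`.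

Note: Jacobson writes `h(x)` for `x ^ (q - 1) * p(x) ^ q` and `bⱼ` for its coefficients.
-/
theorem exp_polynomial_approx_aux (f : ℤ[X]) (s : ℂ) :
    ∃ c ≥ 0,
      ∀ p ≠ 0, ‖P (map (algebraMap ℤ ℂ) (X ^ (p - 1) * f ^ p)) s‖ ≤ c ^ p := by
  have : Bornology.IsBounded
      (Set.image (fun x : ℝ ↦ max (x * ‖s‖) 1 * ‖aeval (x * s) f‖) (Set.Ioc 0 1)) := by
    have h :
      Set.image (fun x : ℝ ↦ max (x * ‖s‖) 1 * ‖aeval (x * s) f‖) (Set.Ioc 0 1) ⊆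
        Set.image (fun x : ℝ ↦ max (x * ‖s‖) 1 * ‖aeval (x * s) f‖) (Set.Icc 0 1) :=
      Set.image_mono Set.Ioc_subset_Icc_self
    refine (IsCompact.image isCompact_Icc ?_).isBounded.subset h
    fun_prop
  obtain ⟨c, h⟩ := this.exists_norm_le
  simp_rw [Real.norm_eq_abs] at h
  refine P_le _ s c (fun p x hx => ?_)
  specialize h (max (x * ‖s‖) 1 * ‖aeval (x * s) f‖) (Set.mem_image_of_mem _ hx)
  grw [← h]
  simp_rw [Polynomial.map_mul, Polynomial.map_pow, map_X, eval_mul, eval_pow, eval_X, norm_mul,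
    Complex.norm_pow, real_smul, norm_mul, norm_real, ← eval₂_eq_eval_map, ← aeval_def, abs_mul,
    abs_norm, mul_pow, Real.norm_of_nonneg hx.1.le]
  refine mul_le_mul_of_nonneg_right ?_ (pow_nonneg (norm_nonneg _) _)
  rw [← mul_pow, abs_of_nonneg (by positivity), max_def]
  split_ifs with hx1
  · rw [one_pow]
    exact pow_le_one₀ (mul_nonneg hx.1.le (norm_nonneg _)) hx1
  · push Not at hx1
    exact pow_le_pow_right₀ hx1.le (Nat.sub_le _ _)

theorem exp_polynomial_approx_quant (f : ℤ[X]) (hf : f.eval 0 ≠ 0) :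
    ∃ c : ℝ, 0 ≤ c ∧
      ∀ p > (eval 0 f).natAbs, p.Prime →
        ∃ n : ℤ, ¬ ↑p ∣ n ∧ |(n:ℝ)| ≤ c ^ p * (p * (f.natDegree + 1))! ∧ ∃ gp : ℤ[X], gp.natDegree ≤ p * f.natDegree - 1 ∧
          ∀ {r : ℂ}, r ∈ f.aroots ℂ →
            ‖n • exp r - p • aeval r gp‖ ≤ c ^ p / (p - 1)! := by
  simp_rw [nsmul_eq_mul, zsmul_eq_mul]
  choose c' c'0 Pp'_le using exp_polynomial_approx_aux f
  obtain ⟨C, C0, hC⟩ := coeff_pow_bound f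
  obtain ⟨c, hcC, hc⟩ : ∃ c, C ≤ c ∧ ∀ r ∈ f.aroots ℂ, c' r ≤ c := by
    refine ⟨C + ∑ r ∈ (f.aroots ℂ).toFinset, c' r, ?_, fun r hr => ?_⟩
    · have := Finset.sum_nonneg (s := (f.aroots ℂ).toFinset) (fun r _ => c'0 r)
      linarith
    · have := Finset.single_le_sum (s := (f.aroots ℂ).toFinset) (fun r _ => c'0 r)
        (Multiset.mem_toFinset.mpr hr)
      linarith
  refine ⟨c, C0.trans hcC, ?_⟩
  intro p p_gt prime_p
  obtain ⟨gp', -, h'⟩ := eval_sumIDeriv_of_pos (X ^ (p - 1) * f ^ p) prime_p.pos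
  specialize h' 0 (by rw [C_0, sub_zero])
  use f.eval 0 ^ p + p * gp'.eval 0
  constructor
  · rw [dvd_add_left (dvd_mul_right _ _)]
    contrapose! p_gt with h
    exact Nat.le_of_dvd (Int.natAbs_pos.mpr hf) (Int.natCast_dvd.mp (Int.Prime.dvd_pow' prime_p h))
  constructor
  · have h1 := eval_sumIDeriv_bound f C C0 hC p prime_p.pos
    rw [h'] at h1
    have h2 : ((p - 1)! • eval 0 (f ^ p) + p ! • eval 0 gp' : ℤ) =
        ((p - 1)! : ℤ) * (eval 0 f ^ p + p * eval 0 gp') := by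
      rw [← Nat.mul_factorial_pred prime_p.ne_zero]; simp; ring
    rw [h2, Int.cast_mul, abs_mul] at h1
    have h3 : (1:ℝ) ≤ |(((p - 1)! : ℤ) : ℝ)| := by
      rw [Int.cast_natCast, Nat.abs_cast]
      exact_mod_cast Nat.factorial_pos _
    refine le_trans (le_mul_of_one_le_left (abs_nonneg _) h3) (h1.trans ?_)
    gcongr
  obtain ⟨gp, gp'_le, h⟩ := aeval_sumIDeriv ℂ (X ^ (p - 1) * f ^ p) p
  refine ⟨gp, ?_, ?_⟩
  · refine gp'_le.trans ((tsub_le_tsub_right natDegree_mul_le p).trans ?_)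
    rw [natDegree_X_pow, natDegree_pow, tsub_add_eq_add_tsub prime_p.one_le, tsub_right_comm,
      add_tsub_cancel_left]
  intro r hr
  specialize h r _
  · rw [mem_roots'] at hr
    rw [Polynomial.map_mul, f.map_pow]
    exact dvd_mul_of_dvd_right (pow_dvd_pow_of_dvd (dvd_iff_isRoot.mpr hr.2) _) _
  rw [nsmul_eq_mul] at h
  have :
      (↑(eval 0 f ^ p + p * eval 0 gp') * cexp r - p * (aeval r) gp) * (p - 1)! =
      ((eval 0 f ^ p * cexp r) * (p - 1)! +
        ↑(p * (p - 1)!) * (eval 0 gp' * cexp r - (aeval r) gp)) := by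
    push_cast; ring
  rw [le_div_iff₀ (Nat.cast_pos.mpr (Nat.factorial_pos _) : (0 : ℝ) < _), ← norm_natCast,
    ← norm_mul, this, Nat.mul_factorial_pred prime_p.ne_zero, mul_sub, ← h]
  have :
      ↑(eval 0 f) ^ p * cexp r * ↑(p - 1)! +
        (↑p ! * (↑(eval 0 gp') * cexp r) - (aeval r) (sumIDeriv (X ^ (p - 1) * f ^ p))) =
      ((p - 1)! • ↑(eval 0 (f ^ p)) + p ! • ↑(eval 0 gp') : ℤ) * cexp r -
        (aeval r) (sumIDeriv (X ^ (p - 1) * f ^ p)) := by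
    simp; ring
  rw [this, ← h', mul_comm, ← eq_intCast (algebraMap ℤ ℂ),
    ← aeval_algebraMap_apply_eq_algebraMap_eval, map_zero,
    aeval_sumIDeriv_eq_eval, aeval_sumIDeriv_eq_eval, ← P]
  refine (Pp'_le r p prime_p.ne_zero).trans (pow_le_pow_left₀ (c'0 r) ?_ _)
  exact hc r hr

end

end LAT
namespace LAT

open Filter
open scoped Nat

theorem factorial_mul_le (k M : ℕ) :
    ((k * M)! : ℝ) ≤ ((k : ℝ) ^ k * Real.exp 1 ^ k) ^ M * (M ! : ℝ) ^ k := by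
  have h1 : ((k * M)! : ℝ) ≤ ((k * M : ℕ) : ℝ) ^ (k * M) := by
    exact_mod_cast Nat.factorial_le_pow (k * M)
  have h2 : (M : ℝ) ^ M ≤ Real.exp 1 ^ M * M ! := by
    have := Real.pow_div_factorial_le_exp (M : ℝ) (by positivity) M
    rw [div_le_iff₀ (by positivity)] at this
    rwa [← Real.exp_nat_mul, mul_one]
  calc _ ≤ _ := h1
    _ = ((k : ℝ) ^ k) ^ M * ((M : ℝ) ^ M) ^ k := by
        push_cast; rw [mul_pow, ← pow_mul, ← pow_mul, mul_comm M k]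
    _ ≤ ((k : ℝ) ^ k) ^ M * (Real.exp 1 ^ M * M !) ^ k := by gcongr
    _ = _ := by rw [mul_pow, mul_pow, ← pow_mul, ← pow_mul, ← pow_mul, mul_comm M k]; ring

theorem pow_aux (c E d u : ℝ) (m n : ℕ) :
    c ^ m * (E ^ m * (d ^ m * u) ^ n) = (c * E * d ^ n) ^ m * u ^ n := by
  rw [mul_pow (d ^ m), mul_pow (c * E), mul_pow c E, ← pow_mul, ← pow_mul, mul_comm m n]
  ring

theorem exists_prime_choice (B C₁ : ℝ) (hB : 1 ≤ B) (hC₁ : 0 < C₁) (g N l₀ : ℕ) :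
    ∃ (C₃ : ℝ) (k : ℕ), 0 < C₃ ∧ ∀ q : ℝ, 1 ≤ q → ∃ l : ℕ, l.Prime ∧ l₀ < l ∧
      C₁ * q ^ g * B ^ l / (l - 1)! ≤ 1 / 2 ∧ B ^ l * (l * N)! ≤ C₃ * q ^ k := by
  set c : ℝ := B ^ 2 with hc
  have hc1 : 1 ≤ c := one_le_pow₀ hB
  have hc0 : 0 < c := by linarith
  set n : ℕ := 2 * N with hn
  set A : ℝ := c * ((n : ℝ) ^ n * Real.exp 1 ^ n) * (2 * c) ^ n + 1 with hA
  have hA0 : 0 ≤ c * ((n : ℝ) ^ n * Real.exp 1 ^ n) * (2 * c) ^ n := by positivity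
  have hApos : 0 < A := by linarith
  have key : ∀ x : ℝ, ∀ᶠ m : ℕ in atTop, x ^ m ≤ m ! := by
    intro x
    have := (FloorSemiring.tendsto_pow_div_factorial_atTop x).eventually (gt_mem_nhds one_pos)
    filter_upwards [this] with m hm
    rw [div_lt_one (by positivity)] at hm
    exact hm.le
  obtain ⟨m₀, hm₀⟩ := eventually_atTop.mp (key (A * c))
  set m₁ := max m₀ l₀ + 1 with hm₁
  set X₀ : ℝ := 2 * C₁ + m₁ ! + 1 with hX₀
  have hX₀pos : 0 < X₀ := by positivity
  refine ⟨A * X₀ ^ (n + 1), g * (n + 1), by positivity, fun q hq => ?_⟩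
  have hqg : 1 ≤ q ^ g := one_le_pow₀ hq
  set X := X₀ * q ^ g with hX
  have hXX : X₀ ≤ X := le_mul_of_one_le_right hX₀pos.le hqg
  have hXpos : 0 < X := by positivity
  have hex : ∃ m : ℕ, X * c ^ m ≤ m ! := by
    have h2 := key (X * c + c)
    obtain ⟨m, hm, hm1⟩ := (h2.and (eventually_ge_atTop 1)).exists
    refine ⟨m, le_trans ?_ hm⟩
    by_cases hX1 : 1 ≤ X
    · calc X * c ^ m ≤ X ^ m * c ^ m := by
            gcongr; exact le_self_pow₀ hX1 (by omega)
        _ = (X * c) ^ m := (mul_pow X c m).symm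
        _ ≤ _ := by gcongr; linarith
    · push Not at hX1
      calc X * c ^ m ≤ 1 * c ^ m := by gcongr
        _ ≤ _ := by rw [one_mul]; gcongr; nlinarith
  classical
  set m := Nat.find hex with hm
  have hmspec : X * c ^ m ≤ m ! := Nat.find_spec hex
  have hmlarge : m₁ < m := by
    by_contra hlt
    push Not at hlt
    have h1 : (m ! : ℝ) ≤ m₁ ! := by exact_mod_cast Nat.factorial_le hlt
    have h2 : X ≤ X * c ^ m := le_mul_of_one_le_right hXpos.le (one_le_pow₀ hc1)
    linarith
  obtain ⟨r, hr⟩ : ∃ r, m = r + 1 := ⟨m - 1, by omega⟩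
  have hrlt : (r ! : ℝ) < X * c ^ r := by
    have := Nat.find_min hex (m := r) (by omega)
    push Not at this
    exact this
  obtain ⟨l, hl, hml, hl2⟩ := Nat.exists_prime_lt_and_le_two_mul m (by omega)
  refine ⟨l, hl, by omega, ?_, ?_⟩
  · have hfac : (m ! : ℝ) ≤ (l - 1)! := by exact_mod_cast Nat.factorial_le (by omega)
    rw [div_le_iff₀ (by positivity)]
    have hBl : B ^ l ≤ c ^ m := by
      rw [hc, ← pow_mul]; exact pow_le_pow_right₀ hB hl2
    calc C₁ * q ^ g * B ^ l ≤ C₁ * q ^ g * c ^ m := by gcongr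
      _ ≤ (1 / 2) * (X * c ^ m) := by
          rw [hX, hX₀]
          have h1 : 0 ≤ q ^ g * c ^ m := by positivity
          have h2 : (0:ℝ) ≤ m₁ ! := by positivity
          nlinarith [mul_nonneg h1 h2]
      _ ≤ _ := by linarith
  · have hBl : B ^ l ≤ c ^ m := by
      rw [hc, ← pow_mul]; exact pow_le_pow_right₀ hB hl2
    have hf1 : ((l * N)! : ℝ) ≤ (n * m)! := by
      have : l * N ≤ n * m := by rw [hn]; nlinarith
      exact_mod_cast Nat.factorial_le this
    have hm2 : (m ! : ℝ) ≤ (2 * c) ^ m * (r ! / c ^ r) := by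
      have h2 : (m : ℝ) ≤ 2 ^ m := by exact_mod_cast Nat.lt_two_pow_self.le
      have h3 : (m ! : ℝ) = m * r ! := by rw [hr, Nat.factorial_succ]; push_cast; ring
      rw [h3]
      calc (m : ℝ) * r ! ≤ 2 ^ m * r ! := by gcongr
        _ ≤ 2 ^ m * c * r ! := by
            have : (0:ℝ) ≤ 2 ^ m * r ! := by positivity
            nlinarith
        _ = _ := by rw [mul_pow, hr, pow_succ c]; field_simp
    have hu : (r ! : ℝ) / c ^ r ≤ X := by
      rw [div_le_iff₀ (by positivity)]; exact hrlt.le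
    have hAr : A ^ r ≤ (r ! : ℝ) / c ^ r := by
      rw [le_div_iff₀ (by positivity), ← mul_pow]
      exact hm₀ r (by omega)
    have hu0 : (0:ℝ) ≤ r ! / c ^ r := by positivity
    calc B ^ l * (l * N)! ≤ c ^ m * (n * m)! := by gcongr
      _ ≤ c ^ m * (((n : ℝ) ^ n * Real.exp 1 ^ n) ^ m * (m ! : ℝ) ^ n) := by
          gcongr; exact factorial_mul_le n m
      _ ≤ c ^ m * (((n : ℝ) ^ n * Real.exp 1 ^ n) ^ m * ((2 * c) ^ m * (r ! / c ^ r)) ^ n) := by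
          gcongr
      _ = (c * ((n : ℝ) ^ n * Real.exp 1 ^ n) * (2 * c) ^ n) ^ m * (r ! / c ^ r) ^ n := by
          exact pow_aux _ _ _ _ _ _
      _ ≤ A ^ m * (r ! / c ^ r) ^ n := by gcongr; linarith
      _ = A * A ^ r * (r ! / c ^ r) ^ n := by rw [hr, pow_succ']
      _ ≤ A * X * X ^ n := by
          gcongr
          exact hAr.trans hu
      _ = A * X₀ ^ (n + 1) * q ^ (g * (n + 1)) := by
          rw [mul_assoc, ← pow_succ', hX, mul_pow, ← pow_mul, mul_assoc]

end LAT
namespace LAT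

/-- signs -/
def sg : Fin 3 → ℤ := ![0, 1, -1]
/-- coefficients -/
def wt (a b : ℤ) : Fin 3 → ℤ := ![a, b, -b]

/-- exponent attached to a choice -/
def gam {ι K : Type*} [Fintype ι] [Field K] (x : ι → K) (e : ι → Fin 3) : K :=
  ∑ i, (sg (e i) : K) * x i

/-- coefficient attached to a choice -/
def cf {ι : Type*} [Fintype ι] (a b : ℤ) (e : ι → Fin 3) : ℤ := ∏ i, wt a b (e i)

theorem exists_coeff_not_dvd {ι K : Type*} [Fintype ι] [DecidableEq ι] [Field K] [CharZero K]
    [DecidableEq K]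
    (x : ι → K) (hx : ∀ i, x i ≠ 0) (l : ℕ) (hl : l.Prime) (a b : ℤ)
    (hab : ¬ ((l : ℤ) ∣ a ∧ (l : ℤ) ∣ b)) :
    ∃ e' : ι → Fin 3, ¬ (l : ℤ) ∣ ∑ e : ι → Fin 3, if gam x e = gam x e' then cf a b e else 0 := by
  have := Fact.mk hl
  let F : ι → AddMonoidAlgebra (ZMod l) K := fun i =>
    ∑ j : Fin 3, AddMonoidAlgebra.single ((sg j : K) * x i) ((wt a b j : ℤ) : ZMod l)
  have hF : ∀ i, F i ≠ 0 := by
    intro i h0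
    have hxi := hx i
    have h2 : -x i ≠ x i := fun h => hxi (self_eq_neg.mp h.symm)
    apply hab
    have e1 : (F i).coeff 0 = 0 := by rw [h0]; rfl
    have e2 : (F i).coeff (x i) = 0 := by rw [h0]; rfl
    simp [F, Fin.sum_univ_three, sg, wt, AddMonoidAlgebra.coeff_single,
      Finsupp.single_apply, hxi, h2, hxi.symm] at e1 e2
    exact ⟨(ZMod.intCast_zmod_eq_zero_iff_dvd _ _).mp e1, (ZMod.intCast_zmod_eq_zero_iff_dvd _ _).mp e2⟩
  have hprod : ∏ i, F i ≠ 0 := Finset.prod_ne_zero_iff.mpr fun i _ => hF i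
  have hexp : ∏ i, F i = ∑ e : ι → Fin 3,
      AddMonoidAlgebra.single (gam x e) ((cf a b e : ℤ) : ZMod l) := by
    simp only [F]
    rw [Finset.prod_univ_sum, Fintype.piFinset_univ]
    refine Finset.sum_congr rfl fun e _ => ?_
    simp only [gam, cf, Int.cast_prod]
    have : ∀ s : Finset ι, ∏ i ∈ s, AddMonoidAlgebra.single ((sg (e i) : K) * x i)
        ((wt a b (e i) : ℤ) : ZMod l) = AddMonoidAlgebra.single (∑ i ∈ s, (sg (e i) : K) * x i)
          (∏ i ∈ s, ((wt a b (e i) : ℤ) : ZMod l)) := by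
      intro s
      induction s using Finset.induction_on with
      | empty => simp [AddMonoidAlgebra.one_def]
      | insert i s hi ih =>
        rw [Finset.prod_insert hi, Finset.sum_insert hi, Finset.prod_insert hi, ih,
          AddMonoidAlgebra.single_mul_single]
    exact this _
  by_contra hcon
  push Not at hcon
  apply hprod
  have hco : ∀ g0 : K, (∏ i, F i).coeff g0 =
      ((∑ e : ι → Fin 3, if gam x e = g0 then cf a b e else 0 : ℤ) : ZMod l) := by
    intro g0
    rw [hexp]
    simp [AddMonoidAlgebra.coeff_sum, AddMonoidAlgebra.coeff_single, Finsupp.finsetSum_apply,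
      Finsupp.single_apply, Int.cast_sum]
  ext g0
  rw [hco]
  by_cases hg : ∃ e', gam x e' = g0
  · obtain ⟨e', rfl⟩ := hg
    rw [(ZMod.intCast_zmod_eq_zero_iff_dvd _ _).mpr (hcon e')]
    rfl
  · push Not at hg
    simp [hg]

theorem prod_expand {ι K : Type*} [Fintype ι] [DecidableEq ι] [Field K] (φ : K →+* ℂ)
    (x : ι → K) (a b : ℤ) :
    ∏ i, ((a : ℂ) + b * Complex.exp (φ (x i)) - b * Complex.exp (-φ (x i))) =
      ∑ e : ι → Fin 3, (cf a b e : ℂ) * Complex.exp (φ (gam x e)) := by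
  have : ∀ i, ((a : ℂ) + b * Complex.exp (φ (x i)) - b * Complex.exp (-φ (x i))) =
      ∑ j : Fin 3, (wt a b j : ℂ) * Complex.exp (φ ((sg j : K) * x i)) := by
    intro i
    simp [Fin.sum_univ_three, sg, wt]
    ring
  simp_rw [this]
  rw [Finset.prod_univ_sum, Fintype.piFinset_univ]
  refine Finset.sum_congr rfl fun e _ => ?_
  rw [Finset.prod_mul_distrib, gam, cf, map_sum, Complex.exp_sum, Int.cast_prod]

theorem cf_bound {ι : Type*} [Fintype ι] (a b : ℤ) (Q : ℝ) (ha : |(a : ℝ)| ≤ Q)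
    (hb : |(b : ℝ)| ≤ Q) (e : ι → Fin 3) : |(cf a b e : ℝ)| ≤ Q ^ Fintype.card ι := by
  rw [cf, Int.cast_prod, Finset.abs_prod, ← Finset.card_univ, ← Finset.prod_const]
  refine Finset.prod_le_prod (fun _ _ => abs_nonneg _) fun i _ => ?_
  have : ∀ j : Fin 3, |(wt a b j : ℝ)| ≤ Q := by
    intro j; fin_cases j <;> simp [wt, ha, hb]
  exact this _

section gal
variable {K : Type*} [Field K] [NumberField K]

/-- action on choices -/
def act (t : Gal(K/ℚ)) : (Gal(K/ℚ) → Fin 3) ≃ (Gal(K/ℚ) → Fin 3) :=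
  Equiv.arrowCongr (Equiv.mulLeft t) (Equiv.refl _)

theorem gam_act (β : K) (t : Gal(K/ℚ)) (e : Gal(K/ℚ) → Fin 3) :
    t (gam (fun s : Gal(K/ℚ) => s β) e) = gam (fun s : Gal(K/ℚ) => s β) (act t e) := by
  simp only [gam, map_sum, map_mul, map_intCast]
  refine Fintype.sum_equiv (Equiv.mulLeft t) _ _ fun s => ?_
  simp [act, Equiv.arrowCongr]

theorem cf_act (a b : ℤ) (t : Gal(K/ℚ)) (e : Gal(K/ℚ) → Fin 3) :
    cf a b (act t e) = cf a b e := by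
  simp only [cf]
  symm
  refine Fintype.prod_equiv (Equiv.mulLeft t) _ _ fun s => ?_
  simp [act, Equiv.arrowCongr]

open scoped Classical in
theorem S_act (β : K) (a b : ℤ) (t : Gal(K/ℚ)) (y : K) :
    (∑ e : Gal(K/ℚ) → Fin 3, if gam (fun s : Gal(K/ℚ) => s β) e = t y then cf a b e else 0) =
    ∑ e : Gal(K/ℚ) → Fin 3, if gam (fun s : Gal(K/ℚ) => s β) e = y then cf a b e else 0 := by
  symm
  refine Fintype.sum_equiv (act t) _ _ fun e => ?_
  rw [← gam_act, cf_act]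
  simp

/-- A Galois invariant algebraic integer is an integer. -/
theorem exists_int [IsGalois ℚ K] (w : K) (hw : IsIntegral ℤ w)
    (hfix : ∀ t : Gal(K/ℚ), t w = w) : ∃ z : ℤ, (z : K) = w := by
  obtain ⟨r, hr⟩ := IntermediateField.mem_bot.mp ((IsGalois.mem_bot_iff_fixed w).mpr hfix)
  rw [← hr] at hw
  have h2 : IsIntegral ℤ r := (isIntegral_algebraMap_iff (algebraMap ℚ K).injective).mp hw
  obtain ⟨z, hz⟩ := IsIntegrallyClosed.isIntegral_iff.mp h2
  refine ⟨z, ?_⟩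
  rw [← hr, ← hz]
  simp

theorem integral_scaled (b : ℤ) (θ : K) (hθ : IsIntegral ℤ ((b : K) * θ)) (g : Polynomial ℤ) (M : ℕ)
    (hM : g.natDegree ≤ M) : IsIntegral ℤ ((b : K) ^ M * Polynomial.aeval θ g) := by
  rw [Polynomial.aeval_eq_sum_range' (Nat.lt_succ_of_le hM), Finset.mul_sum]
  refine IsIntegral.sum _ fun i hi => ?_
  have hi' : i ≤ M := by simpa [Nat.lt_succ_iff] using hi
  obtain ⟨k, rfl⟩ := Nat.exists_eq_add_of_le hi'
  have : (b : K) ^ (i + k) * (g.coeff i • θ ^ i) =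
      ((g.coeff i * b ^ k : ℤ) : K) * ((b : K) * θ) ^ i := by
    rw [zsmul_eq_mul]; push_cast; ring
  rw [this]
  exact (isIntegral_algebraMap (R := ℤ) (x := (g.coeff i * b ^ k : ℤ))).mul (hθ.pow i)

theorem exists_poly (T : Finset K) : ∃ f : Polynomial ℤ, f.eval 0 ≠ 0 ∧
    ∀ θ ∈ T, θ ≠ 0 → Polynomial.aeval θ f = 0 := by
  have h1 : ∀ θ : K, ∃ f : Polynomial ℤ, f.eval 0 ≠ 0 ∧ (θ ≠ 0 → Polynomial.aeval θ f = 0) := by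
    intro θ
    by_cases h : θ = 0
    · exact ⟨1, by simp, fun h' => absurd h h'⟩
    · have halg : IsAlgebraic ℤ θ :=
        (IsFractionRing.isAlgebraic_iff ℤ ℚ K).mpr (Algebra.IsAlgebraic.isAlgebraic θ)
      obtain ⟨f, hf1, hf2⟩ := halg.exists_nonzero_coeff_and_aeval_eq_zero
        (mem_nonZeroDivisors_of_ne_zero h)
      exact ⟨f, by rwa [← Polynomial.coeff_zero_eq_eval_zero], fun _ => hf2⟩
  choose F hF1 hF2 using h1
  refine ⟨∏ θ ∈ T, F θ, ?_, fun θ hθ h0 => ?_⟩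
  · rw [Polynomial.eval_prod]
    exact Finset.prod_ne_zero_iff.mpr fun θ _ => hF1 θ
  · rw [map_prod]
    exact Finset.prod_eq_zero hθ (hF2 θ h0)

theorem exists_den (T : Finset K) : ∃ b : ℤ, b ≠ 0 ∧ ∀ θ ∈ T, IsIntegral ℤ ((b : K) * θ) := by
  obtain ⟨y, hy, h⟩ := exists_integral_multiples ℤ ℚ (L := K) T
  exact ⟨y, hy, fun θ hθ => by simpa [zsmul_eq_mul] using h θ hθ⟩
end gal

end LAT
namespace LAT


open scoped Classical in
/-- The arithmetic heart: a nonzero integer squeezed by the analytic estimates. -/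
theorem core_aux {K : Type*} [Field K] [NumberField K] [IsGalois ℚ K] (φ : K →+* ℂ) (β : K)
    (a b d n : ℤ) (l M : ℕ) (hl : l.Prime) (hld : ¬ (l : ℤ) ∣ d) (hln : ¬ (l : ℤ) ∣ n)
    (hlG : Fintype.card Gal(K/ℚ) < l) (g : Polynomial ℤ) (hg : g.natDegree ≤ M)
    (e' : Gal(K/ℚ) → Fin 3)
    (he' : ¬ (l : ℤ) ∣ ∑ e : Gal(K/ℚ) → Fin 3,
      if gam (fun s : Gal(K/ℚ) => s β) e = gam (fun s : Gal(K/ℚ) => s β) e' then cf a b e else 0)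
    (err Q : ℝ) (herr0 : 0 ≤ err)
    (hcf : ∀ e : Gal(K/ℚ) → Fin 3, |(cf a b e : ℝ)| ≤ Q)
    (hint : ∀ (e : Gal(K/ℚ) → Fin 3) (t : Gal(K/ℚ)),
      IsIntegral ℤ ((d : K) * (gam (fun s : Gal(K/ℚ) => s β) e -
        t (gam (fun s : Gal(K/ℚ) => s β) e'))))
    (happ : ∀ (e : Gal(K/ℚ) → Fin 3) (t : Gal(K/ℚ)),
      gam (fun s : Gal(K/ℚ) => s β) e - t (gam (fun s : Gal(K/ℚ) => s β) e') ≠ 0 →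
      ‖(n : ℂ) * Complex.exp (φ (gam (fun s : Gal(K/ℚ) => s β) e -
        t (gam (fun s : Gal(K/ℚ) => s β) e'))) - l * Polynomial.aeval
          (φ (gam (fun s : Gal(K/ℚ) => s β) e - t (gam (fun s : Gal(K/ℚ) => s β) e'))) g‖ ≤ err) :
    1 ≤ |(d : ℝ)| ^ M * (|(n : ℝ)| *
      ‖(∏ s : Gal(K/ℚ), ((a : ℂ) + b * Complex.exp (φ (s β)) - b * Complex.exp (-φ (s β)))) *
        ∑ t : Gal(K/ℚ), Complex.exp (-φ (t (gam (fun s : Gal(K/ℚ) => s β) e')))‖ +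
      Fintype.card (Gal(K/ℚ) → Fin 3) * Fintype.card Gal(K/ℚ) * (Q * err)) := by
  set x : Gal(K/ℚ) → K := fun s => s β with hx
  set y := gam x e' with hy
  set S := ∑ e : Gal(K/ℚ) → Fin 3, if gam x e = y then cf a b e else 0 with hS
  let w : K := ∑ e : Gal(K/ℚ) → Fin 3, ∑ t : Gal(K/ℚ), (cf a b e : K) *
    (if gam x e - t y = 0 then 0 else (d : K) ^ M * Polynomial.aeval (gam x e - t y) g)
  have hwint : IsIntegral ℤ w := by
    refine IsIntegral.sum _ fun e _ => IsIntegral.sum _ fun t _ => ?_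
    refine IsIntegral.mul (isIntegral_algebraMap (R := ℤ) (x := cf a b e)) ?_
    split_ifs
    · exact isIntegral_zero
    · exact integral_scaled d _ (hint e t) g M hg
  have hwfix : ∀ u : Gal(K/ℚ), u w = w := by
    intro u
    simp only [w, map_sum]
    refine Fintype.sum_equiv (act u) _ _ fun e => ?_
    refine Fintype.sum_equiv (Equiv.mulLeft u) _ _ fun t => ?_
    have h1 : gam x (act u e) - (Equiv.mulLeft u t) y = u (gam x e - t y) := by
      rw [map_sub, gam_act β u e]; rfl
    rw [h1, cf_act, map_mul, map_intCast]
    congr 1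
    by_cases h0 : gam x e - t y = 0
    · simp [h0]
    · have h0' : u (gam x e - t y) ≠ 0 := by
        intro h; exact h0 ((map_eq_zero_iff u u.injective).mp h)
      rw [if_neg h0, if_neg h0', map_mul, map_pow, map_intCast]
      congr 1
      have := Polynomial.map_aeval_eq_aeval_map (φ := RingHom.id ℤ) (ψ := (u : K →+* K))
        (RingHom.ext_int _ _) g (gam x e - t y)
      simpa using this
  obtain ⟨z, hz⟩ := exists_int w hwint hwfix
  -- the integer
  set Z : ℤ := d ^ M * n * (Fintype.card Gal(K/ℚ) * S) + l * z with hZ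
  have hZ0 : Z ≠ 0 := by
    intro h0
    have hdvd : (l : ℤ) ∣ d ^ M * n * (Fintype.card Gal(K/ℚ) * S) := by
      refine ⟨-z, ?_⟩
      rw [hZ] at h0; linarith
    have hp := Nat.prime_iff_prime_int.mp hl
    rcases hp.dvd_or_dvd hdvd with h | h
    · rcases hp.dvd_or_dvd h with h | h
      · exact hld (hp.dvd_of_dvd_pow h)
      · exact hln h
    · rcases hp.dvd_or_dvd h with h | h
      · have := Nat.le_of_dvd Fintype.card_pos (Int.natCast_dvd_natCast.mp h)
        omega
      · exact he' h
  have hZ1 : (1 : ℝ) ≤ |(Z : ℝ)| := by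
    have := Int.one_le_abs hZ0
    exact_mod_cast this
  refine hZ1.trans ?_
  have hzC : (z : ℂ) = φ w := by rw [← hz]; simp
  have hSsum : ((Fintype.card Gal(K/ℚ) : ℂ) * S) = ∑ e : Gal(K/ℚ) → Fin 3, ∑ t : Gal(K/ℚ),
      (cf a b e : ℂ) * (if gam x e - t y = 0 then 1 else 0) := by
    rw [Finset.sum_comm]
    have : ∀ t : Gal(K/ℚ), ∑ e : Gal(K/ℚ) → Fin 3,
        (cf a b e : ℂ) * (if gam x e - t y = 0 then 1 else 0) = S := by
      intro t
      rw [hS, ← S_act β a b t y]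
      push_cast
      refine Finset.sum_congr rfl fun e _ => ?_
      simp only [sub_eq_zero, mul_ite, mul_one, mul_zero]
      rfl
    rw [Finset.sum_congr rfl fun t _ => this t]
    simp
  have hE : (∏ s : Gal(K/ℚ), ((a : ℂ) + b * Complex.exp (φ (s β)) - b * Complex.exp (-φ (s β)))) *
        ∑ t : Gal(K/ℚ), Complex.exp (-φ (t y)) = ∑ e : Gal(K/ℚ) → Fin 3, ∑ t : Gal(K/ℚ),
      (cf a b e : ℂ) * Complex.exp (φ (gam x e - t y)) := by
    rw [prod_expand φ x a b, Finset.sum_mul_sum]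
    refine Finset.sum_congr rfl fun e _ => Finset.sum_congr rfl fun t _ => ?_
    rw [map_sub, sub_eq_add_neg, Complex.exp_add, mul_assoc]
  have hZC : (Z : ℂ) = (d : ℂ) ^ M * (n * (∑ e : Gal(K/ℚ) → Fin 3, ∑ t : Gal(K/ℚ),
      (cf a b e : ℂ) * Complex.exp (φ (gam x e - t y))) -
      ∑ e : Gal(K/ℚ) → Fin 3, ∑ t : Gal(K/ℚ), (cf a b e : ℂ) *
        (if gam x e - t y = 0 then 0 else ((n : ℂ) * Complex.exp (φ (gam x e - t y)) -
          l * Polynomial.aeval (φ (gam x e - t y)) g))) := by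
    rw [hZ]
    push_cast
    rw [hSsum, hzC]
    simp only [w, map_sum, Finset.mul_sum, ← Finset.sum_sub_distrib, ← Finset.sum_add_distrib]
    refine Finset.sum_congr rfl fun e _ => Finset.sum_congr rfl fun t _ => ?_
    by_cases h0 : gam x e - t y = 0
    · simp [h0]; ring
    · have := Polynomial.map_aeval_eq_aeval_map (φ := RingHom.id ℤ) (ψ := φ)
        (RingHom.ext_int _ _) g (gam x e - t y)
      simp only [Polynomial.map_id] at this
      simp only [h0, if_false, map_mul, map_pow, map_intCast, this]
      ring
  have hnorm : |(Z : ℝ)| = ‖(Z : ℂ)‖ := (Complex.norm_intCast Z).symm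
  rw [hnorm, hZC, norm_mul, norm_pow, Complex.norm_intCast, hE]
  refine mul_le_mul_of_nonneg_left ?_ (by positivity)
  refine (norm_sub_le _ _).trans ?_
  rw [norm_mul, Complex.norm_intCast]
  refine add_le_add le_rfl ?_
  have hQ0 : 0 ≤ Q := (abs_nonneg _).trans (hcf e')
  refine (norm_sum_le_of_le _ (fun e _ => norm_sum_le_of_le _ (fun t _ =>
    (?_ : _ ≤ Q * err)))).trans ?_
  · rw [norm_mul, Complex.norm_intCast]
    refine mul_le_mul (hcf e) ?_ (norm_nonneg _) hQ0
    split_ifs with h0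
    · simpa using herr0
    · exact happ e t h0
  · simp [mul_assoc]

end LAT
namespace LAT

theorem core {K : Type*} [Field K] [NumberField K] [IsGalois ℚ K] (φ : K →+* ℂ) (β : K)
    (hβ : β ≠ 0) (R : ℝ) (hR : 0 ≤ R) :
    ∃ (B C₁ C₂ : ℝ) (N g l₀ : ℕ), 1 ≤ B ∧ 0 < C₁ ∧ 0 < C₂ ∧ ∀ p q : ℤ, IsCoprime p q → 0 < q →
      |(p : ℝ)| ≤ R * q → ∀ l : ℕ, l.Prime → l₀ < l →
      1 ≤ C₂ * (q : ℝ) ^ g * ‖Complex.sinh (φ β) - (p : ℂ) / q‖ *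
          (B ^ l * (Nat.factorial (l * N) : ℝ)) +
        C₁ * (q : ℝ) ^ g * B ^ l / (Nat.factorial (l - 1) : ℝ) := by
  classical
  set x : Gal(K/ℚ) → K := fun s => s β with hx
  have hx0 : ∀ s, x s ≠ 0 := fun s h => hβ ((map_eq_zero_iff s s.injective).mp h)
  let T : Finset K := Finset.univ.image
    fun v : (Gal(K/ℚ) → Fin 3) × (Gal(K/ℚ) → Fin 3) × Gal(K/ℚ) => gam x v.1 - v.2.2 (gam x v.2.1)
  have hT : ∀ (e e' : Gal(K/ℚ) → Fin 3) (t : Gal(K/ℚ)), gam x e - t (gam x e') ∈ T := fun e e' t =>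
    Finset.mem_image.mpr ⟨(e, e', t), Finset.mem_univ _, rfl⟩
  obtain ⟨f, hf0, hf⟩ := exists_poly T
  obtain ⟨d, hd0, hd⟩ := exists_den T
  obtain ⟨c, hc0, hc⟩ := exp_polynomial_approx_quant f hf0
  set D := f.natDegree with hD
  set G := Fintype.card Gal(K/ℚ) with hG
  set M₀ : ℝ := 2 * R + 1 +
    ∑ s, (‖Complex.exp (φ (x s))‖ + ‖Complex.exp (-φ (x s))‖) with hM₀
  have hM₀1 : 2 * R + 1 ≤ M₀ := by
    have : 0 ≤ ∑ s, (‖Complex.exp (φ (x s))‖ + ‖Complex.exp (-φ (x s))‖) :=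
      Finset.sum_nonneg fun _ _ => by positivity
    linarith
  have hM₀s : ∀ s, 2 * R + 1 + (‖Complex.exp (φ (x s))‖ + ‖Complex.exp (-φ (x s))‖) ≤ M₀ := by
    intro s
    have := Finset.single_le_sum
      (f := fun s => ‖Complex.exp (φ (x s))‖ + ‖Complex.exp (-φ (x s))‖)
      (fun s _ => by positivity) (Finset.mem_univ s)
    linarith
  have hM₀pos : 0 < M₀ := by linarith
  set C₄ : ℝ := ∑ e', ∑ t : Gal(K/ℚ), ‖Complex.exp (-φ (t (gam x e')))‖ with hC₄
  have hC₄0 : 0 ≤ C₄ := Finset.sum_nonneg fun _ _ => Finset.sum_nonneg fun _ _ => norm_nonneg _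
  have hC₄e : ∀ e', ‖∑ t : Gal(K/ℚ), Complex.exp (-φ (t (gam x e')))‖ ≤ C₄ := by
    intro e'
    refine (norm_sum_le _ _).trans ?_
    exact Finset.single_le_sum
      (f := fun e' => ∑ t : Gal(K/ℚ), ‖Complex.exp (-φ (t (gam x e')))‖)
      (fun _ _ => Finset.sum_nonneg fun _ _ => norm_nonneg _) (Finset.mem_univ e')
  have hGpos : 0 < G := Fintype.card_pos
  have hcard : 0 < Fintype.card (Gal(K/ℚ) → Fin 3) := Fintype.card_pos
  refine ⟨|(d : ℝ)| ^ D * c + 1, Fintype.card (Gal(K/ℚ) → Fin 3) * G * M₀ ^ G,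
    2 * M₀ ^ G * (C₄ + 1), D + 1, G,
    max (max (f.eval 0).natAbs d.natAbs) (max G 2), ?_, by positivity, by positivity, ?_⟩
  · have : 0 ≤ |(d : ℝ)| ^ D * c := by positivity
    linarith
  intro p q hpq hq hpR l hl hll
  have hl1 : (f.eval 0).natAbs < l := by omega
  have hl2 : d.natAbs < l := by omega
  have hl3 : G < l := by omega
  have hl4 : 2 < l := by omega
  have hq' : (0 : ℝ) < q := by exact_mod_cast hq
  obtain ⟨n, hln, hn, gp, hgp, happ⟩ := hc l hl1 hl
  have hp := Nat.prime_iff_prime_int.mp hl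
  have hab : ¬ ((l : ℤ) ∣ -2 * p ∧ (l : ℤ) ∣ q) := by
    rintro ⟨h1, h2⟩
    have h3 : (l : ℤ) ∣ p := by
      rcases hp.dvd_or_dvd h1 with h | h
      · have := Int.le_of_dvd (by norm_num) (Int.dvd_neg.mpr h)
        omega
      · exact h
    exact hp.not_isUnit (hpq.isUnit_of_dvd' h3 h2)
  obtain ⟨e', he'⟩ := exists_coeff_not_dvd x hx0 l hl (-2 * p) q hab
  have hld : ¬ (l : ℤ) ∣ d := by
    intro h
    have := Nat.le_of_dvd (Int.natAbs_pos.mpr hd0) (Int.natCast_dvd.mp h)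
    omega
  have hcf := cf_bound (ι := Gal(K/ℚ)) (-2 * p) q (M₀ * q)
    (by
      push_cast
      rw [abs_mul]
      norm_num
      nlinarith)
    (by rw [abs_of_pos hq']; nlinarith)
  have main := core_aux φ β (-2 * p) q d n l (l * D) hl hld hln hl3 gp (by omega) e'
    (by convert he') (c ^ l / (Nat.factorial (l - 1) : ℝ)) ((M₀ * q) ^ G) (by positivity) hcf
    (fun e t => hd _ (hT e e' t))
    (fun e t h0 => by
      have hroot : φ (gam x e - t (gam x e')) ∈ f.aroots ℂ := by
        rw [Polynomial.mem_aroots]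
        refine ⟨fun h => hf0 (by simp [h]), ?_⟩
        have h1 := Polynomial.map_aeval_eq_aeval_map (φ := RingHom.id ℤ) (ψ := φ)
          (RingHom.ext_int _ _) f (gam x e - t (gam x e'))
        rw [hf _ (hT e e' t) h0, map_zero, Polynomial.map_id] at h1
        exact h1.symm
      simpa [nsmul_eq_mul, zsmul_eq_mul] using happ hroot)
  refine main.trans ?_
  set δ := ‖Complex.sinh (φ β) - (p : ℂ) / q‖ with hδ
  have hprod : ‖∏ s : Gal(K/ℚ), (((-2 * p : ℤ) : ℂ) + q * Complex.exp (φ (s β)) -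
      q * Complex.exp (-φ (s β)))‖ ≤ 2 * δ * (M₀ * q) ^ G := by
    rw [norm_prod, ← Finset.mul_prod_erase _ _ (Finset.mem_univ (1 : Gal(K/ℚ)))]
    have h1 : ‖((-2 * p : ℤ) : ℂ) + q * Complex.exp (φ ((1 : Gal(K/ℚ)) β)) -
        q * Complex.exp (-φ ((1 : Gal(K/ℚ)) β))‖ = 2 * q * δ := by
      have hqc : (q : ℂ) ≠ 0 := by exact_mod_cast hq.ne'
      have : ((-2 * p : ℤ) : ℂ) + q * Complex.exp (φ ((1 : Gal(K/ℚ)) β)) -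
        q * Complex.exp (-φ ((1 : Gal(K/ℚ)) β)) =
          ((2 * q : ℤ) : ℂ) * (Complex.sinh (φ β) - (p : ℂ) / q) := by
        rw [Complex.sinh]
        push_cast
        simp only [AlgEquiv.one_apply]
        field_simp
        ring
      rw [this, norm_mul, Complex.norm_intCast]
      push_cast
      rw [abs_of_pos (by positivity)]
    have h2 : ∏ s ∈ Finset.univ.erase (1 : Gal(K/ℚ)), ‖((-2 * p : ℤ) : ℂ) +
        q * Complex.exp (φ (s β)) - q * Complex.exp (-φ (s β))‖ ≤ (M₀ * q) ^ (G - 1) := by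
      have hce : (Finset.univ.erase (1 : Gal(K/ℚ))).card = G - 1 := by
        rw [Finset.card_erase_of_mem (Finset.mem_univ _), Finset.card_univ]
      rw [← hce, ← Finset.prod_const]
      refine Finset.prod_le_prod (fun _ _ => norm_nonneg _) fun s _ => ?_
      refine (norm_sub_le _ _).trans ((add_le_add (norm_add_le _ _) le_rfl).trans ?_)
      rw [norm_mul, norm_mul, Complex.norm_intCast, Complex.norm_intCast, abs_of_pos hq']
      push_cast
      rw [abs_mul]
      norm_num
      have h3 := mul_le_mul_of_nonneg_right (hM₀s s) hq'.le
      simp only [hx] at h3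
      nlinarith
    rw [h1]
    calc 2 * q * δ * _ ≤ 2 * q * δ * (M₀ * q) ^ (G - 1) := by gcongr
      _ = 2 * δ * (q * (M₀ * q) ^ (G - 1)) := by ring
      _ ≤ 2 * δ * ((M₀ * q) * (M₀ * q) ^ (G - 1)) := by
          gcongr; nlinarith
      _ = 2 * δ * (M₀ * q) ^ G := by
          rw [← pow_succ', Nat.sub_add_cancel hGpos]
  have hB : |(d : ℝ)| ^ (l * D) * c ^ l ≤ (|(d : ℝ)| ^ D * c + 1) ^ l := by
    rw [mul_comm l D, pow_mul, ← mul_pow]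
    gcongr
    linarith
  set B := |(d : ℝ)| ^ D * c + 1 with hBdef
  rw [norm_mul]
  have hδ0 : 0 ≤ δ := norm_nonneg _
  set F₁ : ℝ := (Nat.factorial (l * (D + 1)) : ℝ)
  set F₂ : ℝ := (Nat.factorial (l - 1) : ℝ)
  have hF₂ : 0 < F₂ := by positivity
  set m₃ : ℝ := (Fintype.card (Gal(K/ℚ) → Fin 3) : ℝ)
  calc _ ≤ |(d : ℝ)| ^ (l * D) * ((c ^ l * F₁) * ((2 * δ * (M₀ * q) ^ G) * (C₄ + 1)) +
        m₃ * G * ((M₀ * q) ^ G * (c ^ l / F₂))) := by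
        gcongr
        exact (hC₄e e').trans (by linarith)
    _ = (|(d : ℝ)| ^ (l * D) * c ^ l) * (F₁ * ((2 * δ * (M₀ * q) ^ G) * (C₄ + 1)) +
        m₃ * G * (M₀ * q) ^ G / F₂) := by
        ring
    _ ≤ B ^ l * (F₁ * ((2 * δ * (M₀ * q) ^ G) * (C₄ + 1)) +
        m₃ * G * (M₀ * q) ^ G / F₂) := by
        gcongr
    _ = _ := by
        rw [mul_pow]; ring

theorem exists_galois_field (z : ℂ) (hz : IsAlgebraic ℚ z) :
    ∃ K : IntermediateField ℚ ℂ, NumberField K ∧ IsGalois ℚ K ∧ z ∈ K := by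
  have hi : IsIntegral ℚ z := hz.isIntegral
  set p := minpoly ℚ z
  have hsp : (p.map (algebraMap ℚ ℂ)).Splits := IsAlgClosed.splits _
  have hS : Polynomial.IsSplittingField ℚ (IntermediateField.adjoin ℚ (p.rootSet ℂ)) p :=
    IntermediateField.adjoin_rootSet_isSplittingField hsp
  refine ⟨IntermediateField.adjoin ℚ (p.rootSet ℂ), ?_, ?_, ?_⟩
  · have := Polynomial.IsSplittingField.finiteDimensional
      (IntermediateField.adjoin ℚ (p.rootSet ℂ)) p
    exact { to_charZero := inferInstance, to_finiteDimensional := this }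
  · exact IsGalois.of_separable_splitting_field (p := p) (minpoly.irreducible hi).separable
  · refine IntermediateField.subset_adjoin _ _ ?_
    rw [Polynomial.mem_rootSet]
    exact ⟨minpoly.ne_zero hi, minpoly.aeval _ _⟩

theorem sinh_measure (y : ℝ) (hy0 : y ≠ 0) (hy : IsAlgebraic ℚ y) :
    ∃ (C : ℝ) (k : ℕ), 0 < C ∧ ∀ p q : ℤ, IsCoprime p q → 0 < q →
      C ≤ |Real.sinh y - p / q| * (q : ℝ) ^ k := by
  have hyC : IsAlgebraic ℚ (y : ℂ) := hy.algebraMap (A := ℂ)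
  obtain ⟨K, hK1, hK2, hyK⟩ := exists_galois_field y hyC
  let β : K := ⟨y, hyK⟩
  have hβ : β ≠ 0 := by
    intro h
    have : (y : ℂ) = 0 := congrArg Subtype.val h
    exact hy0 (by exact_mod_cast this)
  obtain ⟨B, C₁, C₂, N, g, l₀, hB, hC₁, hC₂, H⟩ := core (algebraMap K ℂ) β hβ
    (|Real.sinh y| + 1) (by positivity)
  obtain ⟨C₃, k, hC₃, H'⟩ := exists_prime_choice B C₁ hB hC₁ g N l₀
  refine ⟨min 1 (1 / (2 * C₂ * C₃)), g + k, by positivity, fun p q hpq hq => ?_⟩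
  have hq' : (0 : ℝ) < q := by exact_mod_cast hq
  have hq1 : (1 : ℝ) ≤ q := by exact_mod_cast hq
  by_cases hbig : 1 ≤ |Real.sinh y - p / q|
  · refine (min_le_left _ _).trans ?_
    exact one_le_mul_of_one_le_of_one_le hbig (one_le_pow₀ hq1)
  push Not at hbig
  have hpR : |(p : ℝ)| ≤ (|Real.sinh y| + 1) * q := by
    have h1 : |(p : ℝ) / q| ≤ |Real.sinh y| + 1 := by
      have h2 := abs_sub_abs_le_abs_sub ((p : ℝ) / q) (Real.sinh y)
      rw [abs_sub_comm] at h2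
      linarith
    rwa [abs_div, abs_of_pos hq', div_le_iff₀ hq'] at h1
  obtain ⟨l, hl, hll, h1, h2⟩ := H' q hq1
  have h3 := H p q hpq hq hpR l hl hll
  have hδ : ‖Complex.sinh (algebraMap K ℂ β) - (p : ℂ) / q‖ = |Real.sinh y - p / q| := by
    have : algebraMap K ℂ β = (y : ℂ) := rfl
    rw [this, ← Real.norm_eq_abs, ← Complex.norm_real]
    push_cast
    rfl
  rw [hδ] at h3
  set δ := |Real.sinh y - p / q|
  have hδ0 : 0 ≤ δ := abs_nonneg _
  have h4 : C₂ * (q : ℝ) ^ g * δ * (B ^ l * (Nat.factorial (l * N) : ℝ)) ≤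
      C₂ * (q : ℝ) ^ g * δ * (C₃ * (q : ℝ) ^ k) := by gcongr
  refine (min_le_right _ _).trans ?_
  rw [div_le_iff₀ (by positivity), pow_add]
  nlinarith

end LAT

theorem liouville_arsinh_transcendental (α : ℝ) (h : Liouville α) :
    Transcendental ℚ (Real.arsinh α) := by
  intro halg
  have hα0 : α ≠ 0 := by
    intro h0
    have := h.irrational
    rw [h0] at this
    exact this ⟨0, by simp⟩
  have hy0 : Real.arsinh α ≠ 0 := by simpa [Real.arsinh_eq_zero_iff] using hα0
  obtain ⟨C, k, hC, H⟩ := LAT.sinh_measure _ hy0 halg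
  rw [Real.sinh_arsinh] at H
  obtain ⟨m, hm⟩ := exists_pow_lt_of_lt_one hC (by norm_num : (1 / 2 : ℝ) < 1)
  obtain ⟨a, b, hb, -, hlt⟩ := h (k + m)
  have hb2 : (2 : ℝ) ≤ b := by exact_mod_cast hb
  have hb0 : (0 : ℝ) < b := by linarith
  set r : ℚ := (a : ℚ) / b with hr
  have hcop : IsCoprime r.num (r.den : ℤ) := by
    rw [Int.isCoprime_iff_gcd_eq_one]
    exact r.reduced
  have hden : (r.den : ℤ) ≤ b := Int.le_of_dvd (by omega) (by
    rw [hr, ← Rat.divInt_eq_div]; exact Rat.den_dvd a b)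
  have hden' : ((r.den : ℤ) : ℝ) ≤ b := by exact_mod_cast hden
  have hval : (r.num : ℝ) / ((r.den : ℤ) : ℝ) = a / b := by
    have : ((r : ℚ) : ℝ) = a / b := by rw [hr]; push_cast; rfl
    rw [← this, Rat.cast_def]; simp
  have h1 := H r.num r.den hcop (by exact_mod_cast r.den_pos)
  rw [hval] at h1
  have h2 : C ≤ |α - a / b| * (b : ℝ) ^ k := h1.trans (by gcongr)
  have h3 : |α - a / b| * (b : ℝ) ^ k ≤ 1 / (b : ℝ) ^ (k + m) * (b : ℝ) ^ k := by gcongr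
  have h4 : 1 / (b : ℝ) ^ (k + m) * (b : ℝ) ^ k = (1 / (b : ℝ)) ^ m := by
    rw [pow_add, div_pow, one_pow]; field_simp
  have h5 : (1 / (b : ℝ)) ^ m ≤ (1 / 2) ^ m := by gcongr
  linarith
end
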